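/- (Conjecture.) Fix an integer k > 1 and an integer n ≥ 2κ, and let m = n − ⌊(3k+5)/8⌋. Then β_{k,n} − n ∈ (0,1); that is, there exists λ > 0 with n < κλ < n + 1 such that f_k(m;λ) = f_k(m+1;λ) and the distribution has a double mode at the consecutive integers m and m+1. In particular, for every k > 1 there is a denumerable infinity of values of λ for which the Poisson distribution of order k has a double mode. -/

import Mathlib

open scoped BigOperators

/-- The pmf of the Poisson distribution of order `k` with parameter `lam`:
`f_k(n;λ) = e^{-kλ} Σ_{n₁+2n₂+⋯+k n_k = n} λ^{n₁+⋯+n_k}/(n₁!⋯n_k!)`. -/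
noncomputable def poissonOrderKPmf (k : ℕ) (lam : ℝ) (n : ℕ) : ℝ :=
  Real.exp (-(k * lam)) *
    ∑' v : Fin k → ℕ,
      if (∑ i : Fin k, ((i : ℕ) + 1) * v i) = n then
        lam ^ (∑ i : Fin k, v i) / ((∏ i : Fin k, Nat.factorial (v i) : ℕ) : ℝ)
      else 0

/-- The median of the Poisson distribution of order `k` with parameter `lam`:
the least integer `n` such that `P(X ≤ n) ≥ 1/2`. -/
noncomputable def poissonOrderKMedian (k : ℕ) (lam : ℝ) : ℕ :=
  sInf {n : ℕ | (1 : ℝ) / 2 ≤ ∑ j ∈ Finset.range (n + 1), poissonOrderKPmf k lam j}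

/-- The polynomial part of the pmf: `f_k(n;λ) = e^{-kλ} * orderKSum k λ n`. -/
noncomputable def orderKSum (k : ℕ) (lam : ℝ) (n : ℕ) : ℝ :=
  ∑' v : Fin k → ℕ,
    if (∑ i : Fin k, ((i : ℕ) + 1) * v i) = n then
      lam ^ (∑ i : Fin k, v i) / ((∏ i : Fin k, Nat.factorial (v i) : ℕ) : ℝ)
    else 0

theorem finite_weight_eq (k n : ℕ) :
    {v : Fin k → ℕ | (∑ i : Fin k, ((i : ℕ) + 1) * v i) = n}.Finite := by
  refine (Set.finite_Iic (fun _ : Fin k => n)).subset fun v hv i => ?_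
  have h1 : ((i : ℕ) + 1) * v i ≤ n := by
    rw [← (show _ = n from hv)]
    exact Finset.single_le_sum (f := fun i : Fin k => ((i : ℕ) + 1) * v i)
      (fun _ _ => Nat.zero_le _) (Finset.mem_univ i)
  exact (Nat.le_mul_of_pos_left _ (Nat.succ_pos _)).trans h1

theorem summable_weight_eq (k n : ℕ) (g : (Fin k → ℕ) → ℝ) :
    Summable fun v : Fin k → ℕ =>
      if (∑ i : Fin k, ((i : ℕ) + 1) * v i) = n then g v else 0 := by
  refine summable_of_hasFiniteSupport ((finite_weight_eq k n).subset fun v hv => ?_)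
  by_contra h
  exact hv (if_neg h)

theorem orderKSum_zero (k : ℕ) (lam : ℝ) : orderKSum k lam 0 = 1 := by
  unfold orderKSum
  rw [tsum_eq_single (0 : Fin k → ℕ)]
  · simp
  · intro v hv
    refine if_neg fun h => hv ?_
    funext i
    have := Finset.sum_eq_zero_iff.1 h i (Finset.mem_univ i)
    simpa using this

theorem tsum_weight_mul_coord (k n : ℕ) (lam : ℝ) (i : Fin k) :
    (∑' v : Fin k → ℕ, if (∑ i : Fin k, ((i : ℕ) + 1) * v i) = n then
      (v i : ℝ) * (lam ^ (∑ i : Fin k, v i) / ((∏ i : Fin k, Nat.factorial (v i) : ℕ) : ℝ))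
      else 0) =
    lam * if (i : ℕ) + 1 ≤ n then orderKSum k lam (n - (i + 1)) else 0 := by
  have hinj : Function.Injective fun v : Fin k → ℕ => v + Pi.single i 1 := add_left_injective _
  rw [← hinj.tsum_eq]
  · have key : ∀ v : Fin k → ℕ,
        (if (∑ j : Fin k, ((j : ℕ) + 1) * (v + Pi.single i 1 : Fin k → ℕ) j) = n then
          ((v + Pi.single i 1 : Fin k → ℕ) i : ℝ) *
            (lam ^ (∑ j : Fin k, (v + Pi.single i 1 : Fin k → ℕ) j) /
              ((∏ j : Fin k, Nat.factorial ((v + Pi.single i 1 : Fin k → ℕ) j) : ℕ) : ℝ))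
          else 0) =
        lam * if (i : ℕ) + 1 ≤ n then
          (if (∑ j : Fin k, ((j : ℕ) + 1) * v j) = n - (i + 1) then
            lam ^ (∑ j : Fin k, v j) / ((∏ j : Fin k, Nat.factorial (v j) : ℕ) : ℝ) else 0)
          else 0 := by
      intro v
      have e1 : (∑ j : Fin k, ((j : ℕ) + 1) * (v + Pi.single i 1 : Fin k → ℕ) j) =
          (∑ j : Fin k, ((j : ℕ) + 1) * v j) + (i + 1) := by
        simp [mul_add, Finset.sum_add_distrib, Pi.single_apply]
      have e2 : (∑ j : Fin k, (v + Pi.single i 1 : Fin k → ℕ) j) = (∑ j : Fin k, v j) + 1 := by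
        simp [Finset.sum_add_distrib]
      have e3 : (∏ j : Fin k, Nat.factorial ((v + Pi.single i 1 : Fin k → ℕ) j)) =
          (v i + 1) * ∏ j : Fin k, Nat.factorial (v j) := by
        rw [← Finset.mul_prod_erase _ _ (Finset.mem_univ i),
          ← Finset.mul_prod_erase _ (fun j => Nat.factorial (v j)) (Finset.mem_univ i), ← mul_assoc]
        congr 1
        · simp [Nat.factorial_succ]
        · refine Finset.prod_congr rfl fun j hj => ?_
          simp [Finset.ne_of_mem_erase hj]
      rw [e1, e2, e3]
      by_cases h : (i : ℕ) + 1 ≤ n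
      · rw [if_pos h]
        by_cases h' : (∑ j : Fin k, ((j : ℕ) + 1) * v j) = n - (i + 1)
        · rw [if_pos h', if_pos (by omega)]
          have : ((∏ j : Fin k, Nat.factorial (v j) : ℕ) : ℝ) ≠ 0 := by
            exact_mod_cast (Finset.prod_pos fun j _ => Nat.factorial_pos _).ne'
          push_cast at this ⊢
          simp only [Pi.add_apply, Pi.single_eq_same]
          have h2 : (v i : ℝ) + 1 ≠ 0 := by positivity
          push_cast
          field_simp
          ring
        · rw [if_neg h', if_neg (by omega), mul_zero]
      · rw [if_neg h, if_neg (by omega), mul_zero]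
    rw [tsum_congr key, tsum_mul_left]
    congr 1
    by_cases h : (i : ℕ) + 1 ≤ n
    · simp only [if_pos h]; rfl
    · simp only [if_neg h, tsum_zero]
  · intro v hv
    have hvi : v i ≠ 0 := by
      intro h0
      apply hv
      simp [h0]
    refine ⟨v - Pi.single i 1, ?_⟩
    funext j
    by_cases hj : j = i
    · subst hj; simp; omega
    · simp [hj]

theorem orderKSum_rec (k : ℕ) (lam : ℝ) (n : ℕ) :
    (n : ℝ) * orderKSum k lam n =
      lam * ∑ j ∈ Finset.range k,
        ((j : ℝ) + 1) * if j + 1 ≤ n then orderKSum k lam (n - (j + 1)) else 0 := by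
  have h1 : (n : ℝ) * orderKSum k lam n = ∑' v : Fin k → ℕ, ∑ i : Fin k, ((i : ℝ) + 1) *
      if (∑ i : Fin k, ((i : ℕ) + 1) * v i) = n then
      (v i : ℝ) * (lam ^ (∑ i : Fin k, v i) / ((∏ i : Fin k, Nat.factorial (v i) : ℕ) : ℝ))
      else 0 := by
    unfold orderKSum
    rw [← tsum_mul_left]
    refine tsum_congr fun v => ?_
    by_cases h : (∑ i : Fin k, ((i : ℕ) + 1) * v i) = n
    · simp only [if_pos h]
      simp only [← mul_assoc]
      rw [← Finset.sum_mul]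
      congr 1
      rw [← h]; push_cast; rfl
    · simp only [if_neg h, mul_zero, Finset.sum_const_zero]
  rw [h1, Summable.tsum_finsetSum (fun i _ => (summable_weight_eq k n _).mul_left _),
    Finset.sum_range, Finset.mul_sum]
  refine Finset.sum_congr rfl fun i _ => ?_
  rw [tsum_mul_left, tsum_weight_mul_coord]
  ring

theorem orderKSum_pos {k : ℕ} (hk : 0 < k) {lam : ℝ} (hl : 0 < lam) (n : ℕ) :
    0 < orderKSum k lam n := by
  induction n using Nat.strong_induction_on with
  | _ n ih =>
    rcases Nat.eq_zero_or_pos n with rfl | hn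
    · rw [orderKSum_zero]; exact one_pos
    · have h := orderKSum_rec k lam n
      have hnn : ∀ j ∈ Finset.range k, 0 ≤ ((j : ℝ) + 1) *
          if j + 1 ≤ n then orderKSum k lam (n - (j + 1)) else 0 := by
        intro j _
        split_ifs with hj
        · exact mul_nonneg (by positivity) (ih _ (by omega)).le
        · simp
      have h0 : 0 < ∑ j ∈ Finset.range k, ((j : ℝ) + 1) *
          if j + 1 ≤ n then orderKSum k lam (n - (j + 1)) else 0 := by
        refine Finset.sum_pos' hnn ⟨0, Finset.mem_range.2 hk, ?_⟩
        rw [if_pos (by omega)]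
        exact mul_pos (by positivity) (ih _ (by omega))
      have : 0 < (n : ℝ) * orderKSum k lam n := by rw [h]; exact mul_pos hl h0
      exact pos_of_mul_pos_right this (by positivity)

theorem continuous_orderKSum (k : ℕ) (n : ℕ) : Continuous fun lam => orderKSum k lam n := by
  induction n using Nat.strong_induction_on with
  | _ n ih =>
    rcases Nat.eq_zero_or_pos n with rfl | hn
    · simp only [orderKSum_zero]; exact continuous_const
    · have h : (fun lam => orderKSum k lam n) = fun lam => (lam * ∑ j ∈ Finset.range k,
          ((j : ℝ) + 1) * if j + 1 ≤ n then orderKSum k lam (n - (j + 1)) else 0) / n := by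
        funext lam
        rw [← orderKSum_rec]
        field_simp
      rw [h]
      refine (continuous_id.mul
        (continuous_finsetSum _ fun j _ => continuous_const.mul ?_)).div_const _
      split_ifs with hj
      · exact ih _ (by omega)
      · exact continuous_const

/-- The weights of the recursion for `orderKSum`, extended by the value `1` at `0`. -/
noncomputable def recWeight (k : ℕ) (lam : ℝ) (x : ℕ) : ℝ :=
  if x = 0 then 1 else if x ≤ k then x * lam else 0

theorem recWeight_nonneg (k : ℕ) {lam : ℝ} (hl : 0 ≤ lam) (x : ℕ) : 0 ≤ recWeight k lam x := by
  unfold recWeight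
  split_ifs <;> positivity

theorem recWeight_mul_le (k : ℕ) {lam : ℝ} (hl : 2 ≤ lam) {x y : ℕ} (h : x ≤ y) :
    recWeight k lam x * recWeight k lam (y + 1) ≤ recWeight k lam y * recWeight k lam (x + 1) := by
  have hl0 : 0 ≤ lam := by linarith
  rcases h.eq_or_lt with rfl | h
  · rfl
  by_cases hy : y + 1 ≤ k
  · have hxy : (x : ℝ) + 1 ≤ y := by exact_mod_cast h
    have e1 : recWeight k lam (y + 1) = (y + 1) * lam := by simp [recWeight, hy]
    have e2 : recWeight k lam y = y * lam := by
      simp [recWeight, show y ≠ 0 by omega, show y ≤ k by omega]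
    have e3 : recWeight k lam (x + 1) = (x + 1) * lam := by
      simp [recWeight, show x + 1 ≤ k by omega]
    rw [e1, e2, e3]
    rcases Nat.eq_zero_or_pos x with rfl | hx
    · simp only [recWeight, if_true, Nat.cast_zero] at *
      have : (y : ℝ) + 1 ≤ y * lam := by nlinarith
      nlinarith
    · have e4 : recWeight k lam x = x * lam := by
        simp [recWeight, show x ≠ 0 by omega, show x ≤ k by omega]
      rw [e4]
      have : 0 ≤ lam * lam := by positivity
      nlinarith
  · have : recWeight k lam (y + 1) = 0 := by simp [recWeight, hy]
    rw [this, mul_zero]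
    exact mul_nonneg (recWeight_nonneg k hl0 _) (recWeight_nonneg k hl0 _)

theorem orderKSum_rec_weight (k : ℕ) (lam : ℝ) (n : ℕ) :
    (n : ℝ) * orderKSum k lam n =
      ∑ i ∈ Finset.range n, orderKSum k lam i * recWeight k lam (n - i) := by
  rw [orderKSum_rec, Finset.mul_sum,
    ← Finset.sum_range_reflect (fun i => orderKSum k lam i * recWeight k lam (n - i)) n]
  have e2 : ∑ j ∈ Finset.range n, orderKSum k lam (n - 1 - j) *
      recWeight k lam (n - (n - 1 - j)) = ∑ j ∈ Finset.range (max k n),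
        if j < k ∧ j < n then orderKSum k lam (n - (j + 1)) * ((j + 1) * lam) else 0 := by
    rw [← Finset.sum_subset (Finset.range_mono (le_max_right k n))]
    · refine Finset.sum_congr rfl fun j hj => ?_
      have hj := Finset.mem_range.1 hj
      rw [show n - (n - 1 - j) = j + 1 by omega, show n - 1 - j = n - (j + 1) by omega]
      by_cases hjk : j < k
      · simp [recWeight, hjk, hj]
      · simp [recWeight, hjk, show ¬ j + 1 ≤ k by omega]
    · intro j _ hj
      rw [Finset.mem_range] at hj
      simp [hj]
  rw [e2, ← Finset.sum_subset (Finset.range_mono (le_max_left k n))]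
  · refine Finset.sum_congr rfl fun j hj => ?_
    have hj := Finset.mem_range.1 hj
    by_cases hjn : j + 1 ≤ n
    · simp [show j < n from hjn, hj]; ring
    · simp [show ¬ j < n from hjn, hj]
  · intro j _ hj
    rw [Finset.mem_range] at hj
    simp [hj]

/-- The summation formula behind the proof of log-concavity. -/
theorem two_mul_sum_mul_sum_sub (s : Finset ℕ) (X Y r l : ℕ → ℝ) :
    2 * ((∑ i ∈ s, r i * X i) * (∑ i ∈ s, l i * Y i) -
      (∑ i ∈ s, l i * X i) * (∑ i ∈ s, r i * Y i)) =
    ∑ i ∈ s, ∑ j ∈ s, (X i * Y j - X j * Y i) * (r i * l j - l i * r j) := by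
  have e : ∀ i j, (X i * Y j - X j * Y i) * (r i * l j - l i * r j) =
      (r i * X i) * (l j * Y j) - (l i * X i) * (r j * Y j) -
      ((r i * Y i) * (l j * X j) - (l i * Y i) * (r j * X j)) := fun i j => by ring
  simp only [e, Finset.sum_sub_distrib, ← Finset.mul_sum, ← Finset.sum_mul]
  ring

theorem mul_le_mul_of_logConcave {p : ℕ → ℝ} (hp : ∀ i, 0 < p i) {n : ℕ}
    (h : ∀ t, t + 2 ≤ n → p t * p (t + 2) ≤ p (t + 1) ^ 2) {i j : ℕ} (hij : i ≤ j)
    (hj : j + 1 ≤ n) : p i * p (j + 1) ≤ p (i + 1) * p j := by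
  induction j, hij using Nat.le_induction with
  | base => rw [mul_comm]
  | succ j hij ih =>
    have h1 := ih (by omega)
    have h2 := h j (by omega)
    have h3 : p j * (p i * p (j + 1 + 1)) ≤ p j * (p (i + 1) * p (j + 1)) := by
      calc p j * (p i * p (j + 1 + 1)) = p i * (p j * p (j + 2)) := mul_left_comm _ _ _
        _ ≤ p i * p (j + 1) ^ 2 := mul_le_mul_of_nonneg_left h2 (hp i).le
        _ = (p i * p (j + 1)) * p (j + 1) := by ring
        _ ≤ (p (i + 1) * p j) * p (j + 1) := mul_le_mul_of_nonneg_right h1 (hp _).le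
        _ = _ := by ring
    exact le_of_mul_le_mul_left h3 (hp j)

/-- Log-concavity in the second argument (Hansen's criterion). -/
theorem orderKSum_logConcave {k : ℕ} (hk : 0 < k) {lam : ℝ} (hl : 2 ≤ lam) (n : ℕ) :
    orderKSum k lam n * orderKSum k lam (n + 2) ≤ orderKSum k lam (n + 1) ^ 2 := by
  induction n using Nat.strong_induction_on with
  | _ n ih =>
    set p := orderKSum k lam with hpdef
    have hp : ∀ i, 0 < p i := fun i => orderKSum_pos hk (by linarith) i
    set l : ℕ → ℝ := fun i => if i = 0 then 0 else p (i - 1) with hldef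
    have e1 : ∑ i ∈ Finset.range (n + 2), p i * recWeight k lam (n + 1 - i) =
        ((n : ℝ) + 2) * p (n + 1) := by
      rw [Finset.sum_range_succ, ← orderKSum_rec_weight]
      simp [recWeight, ← hpdef]; ring
    have e2 : ∑ i ∈ Finset.range (n + 2), p i * recWeight k lam (n + 2 - i) =
        ((n : ℝ) + 2) * p (n + 2) := by
      rw [← orderKSum_rec_weight]
      simp [← hpdef]
    have e3 : ∑ i ∈ Finset.range (n + 2), l i * recWeight k lam (n + 1 - i) =
        ((n : ℝ) + 1) * p n := by
      rw [Finset.sum_range_succ']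
      simp only [hldef, Nat.add_sub_cancel, Nat.add_eq_zero_iff, one_ne_zero, and_false, if_false,
        if_true, zero_mul, add_zero, Nat.add_sub_add_right]
      rw [Finset.sum_range_succ, ← orderKSum_rec_weight]
      simp [recWeight, ← hpdef]; ring
    have e4 : ∑ i ∈ Finset.range (n + 2), l i * recWeight k lam (n + 2 - i) =
        ((n : ℝ) + 1) * p (n + 1) := by
      rw [Finset.sum_range_succ']
      simp only [hldef, Nat.add_sub_cancel, Nat.add_eq_zero_iff, one_ne_zero, and_false, if_false,
        if_true, zero_mul, add_zero]
      simp only [show ∀ i, n + 2 - (i + 1) = n + 1 - i from fun i => by omega]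
      rw [← orderKSum_rec_weight]
      simp [← hpdef]
    have hX : ∀ i j, i ≤ j → j ≤ n + 1 →
        0 ≤ recWeight k lam (n + 1 - i) * recWeight k lam (n + 2 - j) -
          recWeight k lam (n + 1 - j) * recWeight k lam (n + 2 - i) := by
      intro i j hij hj
      have := recWeight_mul_le k hl (show n + 1 - j ≤ n + 1 - i by omega)
      rw [show n + 1 - j + 1 = n + 2 - j by omega, show n + 1 - i + 1 = n + 2 - i by omega] at this
      linarith
    have hR : ∀ i j, i ≤ j → j ≤ n + 1 → 0 ≤ p i * l j - l i * p j := by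
      intro i j hij hj
      rcases Nat.eq_zero_or_pos i with rfl | hi
      · simp only [hldef, if_true, zero_mul, sub_zero]
        split_ifs
        · simp
        · exact (mul_pos (hp _) (hp _)).le
      rcases hij.eq_or_lt with rfl | hij
      · rw [mul_comm, sub_self]
      obtain ⟨i, rfl⟩ := Nat.exists_eq_add_of_le' hi
      obtain ⟨j, rfl⟩ := Nat.exists_eq_add_of_le' (show 1 ≤ j by omega)
      have := mul_le_mul_of_logConcave hp (n := n + 1)
        (fun t ht => ih t (by omega)) (show i ≤ j by omega) hj
      simp [hldef]
      linarith
    have main := two_mul_sum_mul_sum_sub (Finset.range (n + 2))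
      (fun i => recWeight k lam (n + 1 - i)) (fun i => recWeight k lam (n + 2 - i)) p l
    simp only [e1, e2, e3, e4] at main
    have hnn : 0 ≤ ∑ i ∈ Finset.range (n + 2), ∑ j ∈ Finset.range (n + 2),
        (recWeight k lam (n + 1 - i) * recWeight k lam (n + 2 - j) -
          recWeight k lam (n + 1 - j) * recWeight k lam (n + 2 - i)) * (p i * l j - l i * p j) := by
      refine Finset.sum_nonneg fun i hi => Finset.sum_nonneg fun j hj => ?_
      have hi := Finset.mem_range.1 hi
      have hj := Finset.mem_range.1 hj
      rcases le_total i j with h | h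
      · exact mul_nonneg (hX i j h (by omega)) (hR i j h (by omega))
      · have h1 := hX j i h (by omega)
        have h2 := hR j i h (by omega)
        refine mul_nonneg_of_nonpos_of_nonpos (by linarith) (by linarith)
    rw [← main] at hnn
    have : 0 ≤ ((n : ℝ) + 1) * (n + 2) * (p (n + 1) ^ 2 - p n * p (n + 2)) := by
      nlinarith
    have := nonneg_of_mul_nonneg_right this (by positivity)
    linarith

theorem orderKSum_le_of_eq {k : ℕ} (hk : 0 < k) {lam : ℝ} (hl : 2 ≤ lam) {m : ℕ}
    (h : orderKSum k lam m = orderKSum k lam (m + 1)) (j : ℕ) :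
    orderKSum k lam j ≤ orderKSum k lam m := by
  set p := orderKSum k lam with hpdef
  have hp : ∀ i, 0 < p i := fun i => orderKSum_pos hk (by linarith) i
  have lc : ∀ i j, i ≤ j → p i * p (j + 1) ≤ p (i + 1) * p j := fun i j hij =>
    mul_le_mul_of_logConcave hp (n := j + 1) (fun t _ => orderKSum_logConcave hk hl t) hij le_rfl
  rcases le_total j m with hj | hj
  · induction hj using Nat.decreasingInduction with
    | self => exact le_rfl
    | of_succ i hi ih =>
      have := lc i m hi.le
      rw [← h] at this
      exact (le_of_mul_le_mul_right this (hp m)).trans ih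
  · induction j, hj using Nat.le_induction with
    | base => exact le_rfl
    | succ j hj ih =>
      have := lc m j hj
      rw [← h] at this
      exact (le_of_mul_le_mul_left this (hp m)).trans ih

/-- Log-concavity bounds the values up to `n` from below by the smaller end value. -/
theorem one_le_orderKSum {k : ℕ} (hk : 0 < k) {lam : ℝ} (hl : 2 ≤ lam) {n : ℕ}
    (h : 1 ≤ orderKSum k lam n) {i : ℕ} (hi : i ≤ n) : 1 ≤ orderKSum k lam i := by
  set p := orderKSum k lam with hpdef
  have hp : ∀ i, 0 < p i := fun i => orderKSum_pos hk (by linarith) i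
  have lc : ∀ i j, i ≤ j → p i * p (j + 1) ≤ p (i + 1) * p j := fun i j hij =>
    mul_le_mul_of_logConcave hp (n := j + 1) (fun t _ => orderKSum_logConcave hk hl t) hij le_rfl
  by_contra hlt
  push Not at hlt
  have key : ∀ t, ∃ s, s ≤ t ∧ (p (s + 1) < p s ∨ 1 ≤ p (t + 1)) := by
    intro t
    induction t with
    | zero =>
      refine ⟨0, le_rfl, ?_⟩
      have : p 0 = 1 := orderKSum_zero k lam
      rcases lt_or_ge (p 1) 1 with h1 | h1
      · left; rw [this]; exact h1
      · right; exact h1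
    | succ t ih =>
      obtain ⟨s, hs, h1 | h1⟩ := ih
      · exact ⟨s, by omega, Or.inl h1⟩
      · rcases lt_or_ge (p (t + 1 + 1)) 1 with h2 | h2
        · exact ⟨t + 1, le_rfl, Or.inl (h2.trans_le h1)⟩
        · exact ⟨t, by omega, Or.inr h2⟩
  rcases Nat.eq_zero_or_pos i with rfl | hi0
  · rw [hpdef, orderKSum_zero] at hlt; exact lt_irrefl _ hlt
  obtain ⟨t, rfl⟩ := Nat.exists_eq_add_of_le' hi0
  obtain ⟨s, hs, h1 | h1⟩ := key t
  · have hdec : ∀ j, s ≤ j → p (j + 1) ≤ p j := by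
      intro j hj
      have h2 := lc s j hj
      have h3 : p s * p (j + 1) ≤ p s * p j :=
        h2.trans (mul_le_mul_of_nonneg_right h1.le (hp j).le)
      exact le_of_mul_le_mul_left h3 (hp s)
    have : p n ≤ p (t + 1) := by
      induction n, hi using Nat.le_induction with
      | base => exact le_rfl
      | succ n hn ih2 =>
        have h4 := hdec n (by omega)
        exact h4.trans (ih2 (by linarith))
    linarith
  · linarith

section Fourier

open Real intervalIntegral

/-- `Σ_{j ≤ k} (1 - cos (jθ))`. -/
noncomputable def cosGap (k : ℕ) (θ : ℝ) : ℝ := ∑ j ∈ Finset.range k, (1 - cos ((j + 1) * θ))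

/-- `Σ_{j ≤ k} sin (jθ)`. -/
noncomputable def sinSum (k : ℕ) (θ : ℝ) : ℝ := ∑ j ∈ Finset.range k, sin ((j + 1) * θ)

/-- The Fourier integral representing `π e^{-kλ} * orderKSum k λ n`. -/
noncomputable def fourierInt (k : ℕ) (lam : ℝ) (n : ℤ) : ℝ :=
  ∫ θ in (0 : ℝ)..π, exp (-lam * cosGap k θ) * cos (lam * sinSum k θ - n * θ)

theorem hasDerivAt_cosGap (k : ℕ) (θ : ℝ) :
    HasDerivAt (cosGap k) (∑ j ∈ Finset.range k, ((j : ℝ) + 1) * sin ((j + 1) * θ)) θ := by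
  unfold cosGap
  refine HasDerivAt.fun_sum fun j _ => ?_
  have h : HasDerivAt (fun x : ℝ => ((j : ℝ) + 1) * x) (j + 1) θ := by
    simpa using (hasDerivAt_id θ).const_mul ((j : ℝ) + 1)
  exact (h.cos.const_sub 1).congr_deriv (by ring)

theorem hasDerivAt_sinSum (k : ℕ) (θ : ℝ) :
    HasDerivAt (sinSum k) (∑ j ∈ Finset.range k, ((j : ℝ) + 1) * cos ((j + 1) * θ)) θ := by
  unfold sinSum
  refine HasDerivAt.fun_sum fun j _ => ?_
  have h : HasDerivAt (fun x : ℝ => ((j : ℝ) + 1) * x) (j + 1) θ := by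
    simpa using (hasDerivAt_id θ).const_mul ((j : ℝ) + 1)
  exact h.sin.congr_deriv (mul_comm _ _)

@[fun_prop]
theorem continuous_cosGap (k : ℕ) : Continuous (cosGap k) := by unfold cosGap; fun_prop

@[fun_prop]
theorem continuous_sinSum (k : ℕ) : Continuous (sinSum k) := by unfold sinSum; fun_prop

theorem sinSum_pi (k : ℕ) : sinSum k π = 0 := by
  unfold sinSum
  refine Finset.sum_eq_zero fun j _ => ?_
  have := sin_nat_mul_pi (j + 1)
  push_cast at this
  exact this

theorem fourierInt_rec (k : ℕ) (lam : ℝ) (n : ℤ) :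
    (n : ℝ) * fourierInt k lam n =
      lam * ∑ j ∈ Finset.range k, ((j : ℝ) + 1) * fourierInt k lam (n - (j + 1)) := by
  have hd : ∀ θ : ℝ, HasDerivAt
      (fun θ => exp (-lam * cosGap k θ) * sin (lam * sinSum k θ - n * θ))
      (lam * (∑ j ∈ Finset.range k, ((j : ℝ) + 1) *
        (exp (-lam * cosGap k θ) * cos (lam * sinSum k θ - (n - (j + 1) : ℤ) * θ))) -
        n * (exp (-lam * cosGap k θ) * cos (lam * sinSum k θ - n * θ))) θ := by
    intro θ
    have h1 := ((hasDerivAt_cosGap k θ).const_mul (-lam)).exp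
    have h2 := (((hasDerivAt_sinSum k θ).const_mul lam).fun_sub
      ((hasDerivAt_id θ).const_mul (n : ℝ))).sin
    refine (h1.fun_mul h2).congr_deriv ?_
    have e : ∀ j : ℕ, cos (lam * sinSum k θ - (n - (j + 1) : ℤ) * θ) =
        cos (lam * sinSum k θ - n * θ) * cos ((j + 1) * θ) -
        sin (lam * sinSum k θ - n * θ) * sin ((j + 1) * θ) := by
      intro j
      rw [← cos_add]
      congr 1
      push_cast
      ring
    simp only [e, id, mul_one]
    have e2 : ∀ (E S' C' : ℝ), ∑ j ∈ Finset.range k, ((j : ℝ) + 1) *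
        (E * (C' * cos ((j + 1) * θ) - S' * sin ((j + 1) * θ))) =
        E * C' * (∑ j ∈ Finset.range k, ((j : ℝ) + 1) * cos ((j + 1) * θ)) -
        E * S' * (∑ j ∈ Finset.range k, ((j : ℝ) + 1) * sin ((j + 1) * θ)) := by
      intro E S' C'
      rw [Finset.mul_sum, Finset.mul_sum, ← Finset.sum_sub_distrib]
      exact Finset.sum_congr rfl fun j _ => by ring
    rw [e2]
    ring
  have hc : ∀ m : ℤ, Continuous fun θ : ℝ =>
      exp (-lam * cosGap k θ) * cos (lam * sinSum k θ - m * θ) := fun m => by fun_prop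
  have hint := integral_eq_sub_of_hasDerivAt (a := 0) (b := π) (fun θ _ => hd θ)
    (by
      refine Continuous.intervalIntegrable ?_ _ _
      refine (continuous_const.mul (continuous_finsetSum _ fun j _ => ?_)).sub
        (continuous_const.mul (hc n))
      exact continuous_const.mul (hc _))
  rw [integral_sub, integral_const_mul, integral_const_mul, integral_finsetSum] at hint
  · simp only [integral_const_mul] at hint
    have hb : sin (lam * sinSum k π - n * π) = 0 := by
      rw [sinSum_pi, mul_zero, zero_sub, sin_neg, sin_int_mul_pi, neg_zero]
    have h0 : sinSum k 0 = 0 := by simp [sinSum]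
    rw [hb, h0] at hint
    simp only [mul_zero, sub_self, sin_zero] at hint
    unfold fourierInt
    linarith
  · exact fun j _ => ((hc _).intervalIntegrable _ _).const_mul _
  · refine Continuous.intervalIntegrable ?_ _ _
    exact continuous_const.mul (continuous_finsetSum _ fun j _ => continuous_const.mul (hc _))
  · exact ((hc _).intervalIntegrable _ _).const_mul _

theorem fourierInt_neg (k : ℕ) (lam : ℝ) (m : ℕ) :
    fourierInt k lam (-(m : ℤ)) = if m = 0 then π * exp (-(k * lam)) else 0 := by
  set g : ℂ → ℂ := fun z =>
    Complex.exp ((lam : ℂ) * ∑ j ∈ Finset.range k, (z ^ (j + 1) - 1)) * z ^ m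
    with hg
  have hdiff : Differentiable ℂ g := by
    rw [hg]; fun_prop
  have hmv : circleAverage g 0 1 = g 0 := (hdiff.diffContOnCl).circleAverage
  have hre : ∀ θ : ℝ, (g (circleMap 0 1 θ)).re =
      exp (-lam * cosGap k θ) * cos (lam * sinSum k θ - (-(m : ℤ) : ℤ) * θ) := by
    intro θ
    have hz : circleMap 0 1 θ = Complex.exp (θ * Complex.I) := by simp [circleMap]
    have hpow : ∀ j : ℕ, Complex.exp (θ * Complex.I) ^ j =
        ((cos (j * θ) : ℝ) : ℂ) + ((sin (j * θ) : ℝ) : ℂ) * Complex.I := by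
      intro j
      rw [← Complex.exp_nat_mul]
      rw [← mul_assoc, Complex.exp_mul_I]
      push_cast; rfl
    have hexp : (lam : ℂ) * ∑ j ∈ Finset.range k, (Complex.exp (θ * Complex.I) ^ (j + 1) - 1) =
        ((-lam * cosGap k θ : ℝ) : ℂ) + ((lam * sinSum k θ : ℝ) : ℂ) * Complex.I := by
      simp only [hpow]
      unfold cosGap sinSum
      push_cast
      rw [Finset.mul_sum, Finset.mul_sum, Finset.mul_sum, Finset.sum_mul, ← Finset.sum_add_distrib]
      exact Finset.sum_congr rfl fun j _ => by ring
    rw [hg, hz]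
    simp only
    rw [hexp, ← Complex.exp_nat_mul, ← Complex.exp_add]
    have : ((-lam * cosGap k θ : ℝ) : ℂ) + ((lam * sinSum k θ : ℝ) : ℂ) * Complex.I +
        m * (θ * Complex.I) = ((-lam * cosGap k θ : ℝ) : ℂ) +
          ((lam * sinSum k θ - (-(m : ℤ) : ℤ) * θ : ℝ) : ℂ) * Complex.I := by
      push_cast; ring
    rw [this, Complex.exp_re]
    simp
  have hcont : Continuous fun θ : ℝ => g (circleMap 0 1 θ) :=
    hdiff.continuous.comp (continuous_circleMap 0 1)
  set F : ℝ → ℝ := fun θ => exp (-lam * cosGap k θ) * cos (lam * sinSum k θ - (-(m : ℤ) : ℤ) * θ)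
    with hF
  have hFc : Continuous F := by rw [hF]; fun_prop
  have hfull : ∫ θ in (0 : ℝ)..2 * π, F θ = 2 * π * (g 0).re := by
    rw [← hmv, circleAverage_def, Complex.smul_re, smul_eq_mul]
    have : (∫ θ in (0 : ℝ)..2 * π, g (circleMap 0 1 θ)).re = ∫ θ in (0 : ℝ)..2 * π, F θ := by
      have := Complex.reCLM.intervalIntegral_comp_comm
        (hcont.intervalIntegrable (μ := MeasureTheory.volume) 0 (2 * π))
      simp only [Complex.reCLM_apply] at this
      rw [← this]
      exact integral_congr fun θ _ => hre θ
    rw [this]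
    field_simp
  have hsymm : ∀ θ, F (2 * π - θ) = F θ := by
    intro θ
    have hper : ∀ j : ℕ, ((j : ℝ) + 1) * (2 * π - θ) =
        ((j + 1 : ℕ) : ℝ) * (2 * π) - (j + 1) * θ := by
      intro j; push_cast; ring
    have h1 : cosGap k (2 * π - θ) = cosGap k θ := by
      unfold cosGap
      refine Finset.sum_congr rfl fun j _ => ?_
      rw [hper, cos_nat_mul_two_pi_sub]
    have h2 : sinSum k (2 * π - θ) = -sinSum k θ := by
      unfold sinSum
      rw [← Finset.sum_neg_distrib]
      refine Finset.sum_congr rfl fun j _ => ?_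
      rw [hper, sin_nat_mul_two_pi_sub]
    rw [hF]
    simp only
    rw [h1, h2]
    congr 1
    rw [← cos_neg]
    have : -(lam * -sinSum k θ - (-(m : ℤ) : ℤ) * (2 * π - θ)) =
      (lam * sinSum k θ - (-(m : ℤ) : ℤ) * θ) - (m : ℝ) * (2 * π) := by
      push_cast; ring
    rw [this, cos_sub_nat_mul_two_pi]
  have hhalf : ∫ θ in (0 : ℝ)..2 * π, F θ = 2 * ∫ θ in (0 : ℝ)..π, F θ := by
    rw [← integral_add_adjacent_intervals (hFc.intervalIntegrable 0 π) (hFc.intervalIntegrable π _)]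
    have : ∫ θ in π..(2 * π), F θ = ∫ θ in (0 : ℝ)..π, F θ := by
      have h := integral_comp_sub_left (a := 0) (b := π) F (2 * π)
      simp only [hsymm] at h
      rw [h]
      congr 1 <;> ring
    rw [this]; ring
  have hI : fourierInt k lam (-(m : ℤ)) = ∫ θ in (0 : ℝ)..π, F θ := rfl
  have : fourierInt k lam (-(m : ℤ)) = π * (g 0).re := by
    rw [hI]; linarith
  rw [this]
  have hg0 : g 0 = ((exp (-(k * lam)) : ℝ) : ℂ) * 0 ^ m := by
    rw [hg]
    simp
    left
    congr 1
    ring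
  rw [hg0]
  split_ifs with h
  · subst h; simp
    rw [← Complex.ofReal_natCast, ← Complex.ofReal_mul, ← Complex.ofReal_neg,
      ← Complex.ofReal_exp, Complex.ofReal_re]
  · simp [h]

/-- The Fourier (inversion) formula for the pmf. -/
theorem fourierInt_natCast (k : ℕ) (lam : ℝ) (n : ℕ) :
    fourierInt k lam n = π * exp (-(k * lam)) * orderKSum k lam n := by
  induction n using Nat.strong_induction_on with
  | _ n ih =>
    rcases Nat.eq_zero_or_pos n with rfl | hn
    · have := fourierInt_neg k lam 0
      simpa [orderKSum_zero] using this
    · have h1 := fourierInt_rec k lam n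
      have h2 := orderKSum_rec k lam n
      have hn' : (n : ℝ) ≠ 0 := by positivity
      apply mul_left_cancel₀ hn'
      have h3 : ((n : ℤ) : ℝ) = n := by simp
      rw [h3] at h1
      rw [h1, mul_left_comm, h2, mul_left_comm, Finset.mul_sum (a := π * exp (-(k * lam)))]
      congr 1
      refine Finset.sum_congr rfl fun j _ => ?_
      by_cases hj : j + 1 ≤ n
      · rw [if_pos hj, show ((n : ℤ) - ((j : ℤ) + 1)) = ((n - (j + 1) : ℕ) : ℤ) by omega,
          ih _ (by omega)]
        ring
      · rw [if_neg hj, show ((n : ℤ) - ((j : ℤ) + 1)) = -((j + 1 - n : ℕ) : ℤ) by omega,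
          fourierInt_neg, if_neg (by omega)]
        ring

theorem cosGap_nonneg (k : ℕ) (θ : ℝ) : 0 ≤ cosGap k θ :=
  Finset.sum_nonneg fun _ _ => sub_nonneg.2 (cos_le_one _)

theorem orderKSum_le_exp (k : ℕ) {lam : ℝ} (hl : 0 ≤ lam) (n : ℕ) :
    orderKSum k lam n ≤ exp (k * lam) := by
  have h := fourierInt_natCast k lam n
  have hle : fourierInt k lam n ≤ π := by
    unfold fourierInt
    calc _ ≤ ∫ θ in (0 : ℝ)..π, (1 : ℝ) := by
          refine integral_mono_on pi_pos.le (Continuous.intervalIntegrable (by fun_prop) _ _)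
            (Continuous.intervalIntegrable (by fun_prop) _ _) fun θ _ => ?_
          calc _ ≤ exp (-lam * cosGap k θ) * 1 :=
                mul_le_mul_of_nonneg_left (cos_le_one _) (exp_pos _).le
            _ ≤ 1 := by
                rw [mul_one, exp_le_one_iff]
                nlinarith [mul_nonneg hl (cosGap_nonneg k θ)]
      _ = π := by simp
  rw [h, exp_neg] at hle
  have h2 : orderKSum k lam n / exp (k * lam) ≤ 1 := by
    have : π * (orderKSum k lam n / exp (k * lam)) ≤ π * 1 := by
      calc _ = π * (exp (k * lam))⁻¹ * orderKSum k lam n := by ring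
        _ ≤ _ := by linarith
    exact le_of_mul_le_mul_left this pi_pos
  rwa [div_le_one (exp_pos _)] at h2

/-- The difference of consecutive pmf values as an integral. -/
theorem orderKSum_sub_succ (k : ℕ) (lam : ℝ) (n : ℕ) :
    π * exp (-(k * lam)) * (orderKSum k lam n - orderKSum k lam (n + 1)) =
      2 * ∫ θ in (0 : ℝ)..π, exp (-lam * cosGap k θ) *
        (sin (θ / 2) * sin ((n + 1 / 2) * θ - lam * sinSum k θ)) := by
  have h1 := fourierInt_natCast k lam n
  have h2 := fourierInt_natCast k lam (n + 1)
  rw [mul_sub, ← h1, ← h2]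
  unfold fourierInt
  rw [← integral_sub (Continuous.intervalIntegrable (by fun_prop) _ _)
    (Continuous.intervalIntegrable (by fun_prop) _ _), ← integral_const_mul]
  refine integral_congr fun θ _ => ?_
  have e1 : lam * sinSum k θ - ((n : ℤ) : ℝ) * θ =
      -((n + 1 / 2) * θ - lam * sinSum k θ) + θ / 2 := by push_cast; ring
  have e2 : lam * sinSum k θ - (((n + 1 : ℕ) : ℤ) : ℝ) * θ =
      -((n + 1 / 2) * θ - lam * sinSum k θ) - θ / 2 := by push_cast; ring
  rw [e1, e2, cos_add, cos_sub, sin_neg]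
  ring

end Fourier

section TrigTaylor

theorem nonneg_of_hasDerivAt_nonneg {f f' : ℝ → ℝ} (hf : ∀ x, HasDerivAt f (f' x) x)
    (h0 : f 0 = 0) (h : ∀ x, 0 ≤ x → 0 ≤ f' x) {x : ℝ} (hx : 0 ≤ x) : 0 ≤ f x := by
  have := monotoneOn_of_deriv_nonneg (convex_Ici (0 : ℝ))
    (fun x _ => (hf x).continuousAt.continuousWithinAt)
    (fun x _ => (hf x).differentiableAt.differentiableWithinAt)
    (fun x hx => by
      rw [(hf x).deriv]
      rw [interior_Ici] at hx
      exact h x (le_of_lt hx))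
  rw [← h0]
  exact this Set.self_mem_Ici hx hx

theorem hasDerivAt_pow_div (n : ℕ) (c x : ℝ) :
    HasDerivAt (fun x : ℝ => x ^ (n + 1) / c) ((n + 1) * x ^ n / c) x := by
  simpa using (hasDerivAt_pow (n + 1) x).div_const c

theorem cos_le_quartic {x : ℝ} (hx : 0 ≤ x) : Real.cos x ≤ 1 - x ^ 2 / 2 + x ^ 4 / 24 := by
  have := nonneg_of_hasDerivAt_nonneg (f := fun x => 1 - x ^ 2 / 2 + x ^ 4 / 24 - Real.cos x)
    (f' := fun x => Real.sin x - (x - x ^ 3 / 6))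
    (fun x => ((((hasDerivAt_pow_div 1 2 x).const_sub 1).fun_add
      (hasDerivAt_pow_div 3 24 x)).fun_sub (Real.hasDerivAt_cos x)).congr_deriv
        (by push_cast; ring))
    (by simp) (fun x hx => by linarith [Real.sin_ge_sub_cube hx]) hx
  linarith

theorem sin_le_quintic {x : ℝ} (hx : 0 ≤ x) : Real.sin x ≤ x - x ^ 3 / 6 + x ^ 5 / 120 := by
  have := nonneg_of_hasDerivAt_nonneg (f := fun x => x - x ^ 3 / 6 + x ^ 5 / 120 - Real.sin x)
    (f' := fun x => 1 - x ^ 2 / 2 + x ^ 4 / 24 - Real.cos x)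
    (fun x => ((((hasDerivAt_id' x).fun_sub (hasDerivAt_pow_div 2 6 x)).fun_add
      (hasDerivAt_pow_div 4 120 x)).fun_sub (Real.hasDerivAt_sin x)).congr_deriv
        (by push_cast; ring))
    (by simp) (fun x hx => by linarith [cos_le_quartic hx]) hx
  linarith

theorem cos_ge_sextic {x : ℝ} (hx : 0 ≤ x) :
    1 - x ^ 2 / 2 + x ^ 4 / 24 - x ^ 6 / 720 ≤ Real.cos x := by
  have := nonneg_of_hasDerivAt_nonneg
    (f := fun x => Real.cos x - (1 - x ^ 2 / 2 + x ^ 4 / 24 - x ^ 6 / 720))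
    (f' := fun x => x - x ^ 3 / 6 + x ^ 5 / 120 - Real.sin x)
    (fun x => ((Real.hasDerivAt_cos x).fun_sub ((((hasDerivAt_pow_div 1 2 x).const_sub 1).fun_add
      (hasDerivAt_pow_div 3 24 x)).fun_sub (hasDerivAt_pow_div 5 720 x))).congr_deriv
        (by push_cast; ring))
    (by simp) (fun x hx => by linarith [sin_le_quintic hx]) hx
  linarith

theorem sin_ge_septic {x : ℝ} (hx : 0 ≤ x) :
    x - x ^ 3 / 6 + x ^ 5 / 120 - x ^ 7 / 5040 ≤ Real.sin x := by
  have := nonneg_of_hasDerivAt_nonneg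
    (f := fun x => Real.sin x - (x - x ^ 3 / 6 + x ^ 5 / 120 - x ^ 7 / 5040))
    (f' := fun x => Real.cos x - (1 - x ^ 2 / 2 + x ^ 4 / 24 - x ^ 6 / 720))
    (fun x => ((Real.hasDerivAt_sin x).fun_sub ((((hasDerivAt_id' x).fun_sub
      (hasDerivAt_pow_div 2 6 x)).fun_add (hasDerivAt_pow_div 4 120 x)).fun_sub
      (hasDerivAt_pow_div 6 5040 x))).congr_deriv (by push_cast; ring))
    (by simp) (fun x hx => by linarith [cos_ge_sextic hx]) hx
  linarith

end TrigTaylor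

section PowerSums

/-- The power sum `1 ^ p + ⋯ + k ^ p`. -/
noncomputable def powSum (k p : ℕ) : ℝ := ∑ j ∈ Finset.range k, ((j : ℝ) + 1) ^ p

theorem powSum_eq_of_succ {p : ℕ} {f : ℝ → ℝ} (h0 : f 0 = 0)
    (h : ∀ x, f (x + 1) = f x + (x + 1) ^ p) (k : ℕ) : powSum k p = f k := by
  unfold powSum
  induction k with
  | zero => simp [h0]
  | succ k ih => rw [Finset.sum_range_succ, ih, Nat.cast_succ, h]

theorem powSum_two (k : ℕ) : powSum k 2 = (k + 1 / 2) * (k * (k + 1)) / 3 :=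
  powSum_eq_of_succ (f := fun x => (x + 1 / 2) * (x * (x + 1)) / 3) (by ring)
    (fun x => by ring) k

theorem powSum_three (k : ℕ) : powSum k 3 = ((k : ℝ) * (k + 1)) ^ 2 / 4 :=
  powSum_eq_of_succ (f := fun x => (x * (x + 1)) ^ 2 / 4) (by ring) (fun x => by ring) k

theorem powSum_four (k : ℕ) : powSum k 4 = powSum k 2 * ((3 * ((k : ℝ) * (k + 1)) - 1) / 5) := by
  rw [powSum_two]
  refine (powSum_eq_of_succ (f := fun x => (x + 1 / 2) * (x * (x + 1)) / 3 *
    ((3 * (x * (x + 1)) - 1) / 5)) (by ring) (fun x => by ring) k)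

theorem powSum_five (k : ℕ) :
    powSum k 5 = ((k : ℝ) * (k + 1)) ^ 2 * (2 * ((k : ℝ) * (k + 1)) - 1) / 12 :=
  powSum_eq_of_succ (f := fun x => (x * (x + 1)) ^ 2 * (2 * (x * (x + 1)) - 1) / 12) (by ring)
    (fun x => by ring) k

theorem powSum_six (k : ℕ) : powSum k 6 =
    powSum k 2 * ((3 * ((k : ℝ) * (k + 1)) ^ 2 - 3 * ((k : ℝ) * (k + 1)) + 1) / 7) := by
  rw [powSum_two]
  refine (powSum_eq_of_succ (f := fun x => (x + 1 / 2) * (x * (x + 1)) / 3 *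
    ((3 * (x * (x + 1)) ^ 2 - 3 * (x * (x + 1)) + 1) / 7)) (by ring) (fun x => by ring) k)

theorem powSum_seven (k : ℕ) : powSum k 7 = ((k : ℝ) * (k + 1)) ^ 2 *
    (3 * ((k : ℝ) * (k + 1)) ^ 2 - 4 * ((k : ℝ) * (k + 1)) + 2) / 24 :=
  powSum_eq_of_succ (f := fun x => (x * (x + 1)) ^ 2 *
    (3 * (x * (x + 1)) ^ 2 - 4 * (x * (x + 1)) + 2) / 24) (by ring) (fun x => by ring) k

theorem powSum_eight_le (k : ℕ) : powSum k 8 ≤ powSum k 2 * (k + 1 / 2) ^ 6 := by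
  unfold powSum
  rw [Finset.sum_mul]
  refine Finset.sum_le_sum fun j hj => ?_
  have h : (j : ℝ) + 1 ≤ k := by exact_mod_cast Finset.mem_range.1 hj
  rw [show 8 = 2 + 6 from rfl, pow_add]
  exact mul_le_mul_of_nonneg_left (pow_le_pow_left₀ (by positivity) (by linarith) 6)
    (by positivity)

/-- `Σ_{j ≤ k} j sin (jθ)`, the derivative of `cosGap`. -/
noncomputable def mulSinSum (k : ℕ) (θ : ℝ) : ℝ :=
  ∑ j ∈ Finset.range k, ((j : ℝ) + 1) * Real.sin ((j + 1) * θ)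

/-- `Σ_{j ≤ k} j (1 - cos (jθ))`, the derivative of `κθ - sinSum`. -/
noncomputable def mulCosGap (k : ℕ) (θ : ℝ) : ℝ :=
  ∑ j ∈ Finset.range k, ((j : ℝ) + 1) * (1 - Real.cos ((j + 1) * θ))

@[fun_prop]
theorem continuous_mulSinSum (k : ℕ) : Continuous (mulSinSum k) := by unfold mulSinSum; fun_prop

@[fun_prop]
theorem continuous_mulCosGap (k : ℕ) : Continuous (mulCosGap k) := by unfold mulCosGap; fun_prop

theorem hasDerivAt_sub_sinSum (k : ℕ) (θ : ℝ) :
    HasDerivAt (fun θ => powSum k 1 * θ - sinSum k θ) (mulCosGap k θ) θ := by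
  refine (((hasDerivAt_id' θ).const_mul (powSum k 1)).fun_sub
    (hasDerivAt_sinSum k θ)).congr_deriv ?_
  unfold powSum mulCosGap
  rw [mul_one, ← Finset.sum_sub_distrib]
  exact Finset.sum_congr rfl fun j _ => by ring

variable (k : ℕ) {θ : ℝ}

theorem cosGap_le : cosGap k θ ≤ powSum k 2 * θ ^ 2 / 2 := by
  unfold cosGap powSum
  rw [Finset.sum_mul, Finset.sum_div]
  refine Finset.sum_le_sum fun j _ => ?_
  have := Real.one_sub_sq_div_two_le_cos (x := (j + 1) * θ)
  linarith [mul_pow ((j : ℝ) + 1) θ 2]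

theorem cosGap_ge (hθ : 0 ≤ θ) : powSum k 2 * θ ^ 2 / 2 - powSum k 4 * θ ^ 4 / 24 ≤ cosGap k θ := by
  unfold cosGap powSum
  simp only [Finset.sum_mul, Finset.sum_div, ← Finset.sum_sub_distrib]
  refine Finset.sum_le_sum fun j _ => ?_
  have := cos_le_quartic (x := (j + 1) * θ) (by positivity)
  simp only [mul_pow] at this
  linarith

theorem sub_sinSum_nonneg (hθ : 0 ≤ θ) : 0 ≤ powSum k 1 * θ - sinSum k θ := by
  unfold sinSum powSum
  simp only [Finset.sum_mul, ← Finset.sum_sub_distrib]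
  refine Finset.sum_nonneg fun j _ => ?_
  have := Real.sin_le (x := (j + 1) * θ) (by positivity)
  linarith

theorem sub_sinSum_le (hθ : 0 ≤ θ) : powSum k 1 * θ - sinSum k θ ≤ powSum k 3 * θ ^ 3 / 6 := by
  unfold sinSum powSum
  simp only [Finset.sum_mul, Finset.sum_div, ← Finset.sum_sub_distrib]
  refine Finset.sum_le_sum fun j _ => ?_
  have := Real.sin_ge_sub_cube (x := (j + 1) * θ) (by positivity)
  simp only [mul_pow] at this
  linarith

theorem mulSinSum_ge (hθ : 0 ≤ θ) : powSum k 2 * θ - powSum k 4 * θ ^ 3 / 6 ≤ mulSinSum k θ := by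
  unfold mulSinSum powSum
  simp only [Finset.sum_mul, Finset.sum_div, ← Finset.sum_sub_distrib]
  refine Finset.sum_le_sum fun j _ => ?_
  have := mul_le_mul_of_nonneg_left (Real.sin_ge_sub_cube (x := (j + 1) * θ) (by positivity))
    (by positivity : 0 ≤ (j : ℝ) + 1)
  refine le_trans (le_of_eq ?_) this
  ring

theorem mulSinSum_le_quintic (hθ : 0 ≤ θ) : mulSinSum k θ ≤
    powSum k 2 * θ - powSum k 4 * θ ^ 3 / 6 + powSum k 6 * θ ^ 5 / 120 := by
  unfold mulSinSum powSum
  simp only [Finset.sum_mul, Finset.sum_div, ← Finset.sum_sub_distrib, ← Finset.sum_add_distrib]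
  refine Finset.sum_le_sum fun j _ => ?_
  have := mul_le_mul_of_nonneg_left (sin_le_quintic (x := (j + 1) * θ) (by positivity))
    (by positivity : 0 ≤ (j : ℝ) + 1)
  refine this.trans (le_of_eq ?_)
  ring

theorem mulSinSum_ge_septic (hθ : 0 ≤ θ) :
    powSum k 2 * θ - powSum k 4 * θ ^ 3 / 6 + powSum k 6 * θ ^ 5 / 120 -
      powSum k 8 * θ ^ 7 / 5040 ≤ mulSinSum k θ := by
  unfold mulSinSum powSum
  simp only [Finset.sum_mul, Finset.sum_div, ← Finset.sum_sub_distrib, ← Finset.sum_add_distrib]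
  refine Finset.sum_le_sum fun j _ => ?_
  have := mul_le_mul_of_nonneg_left (sin_ge_septic (x := (j + 1) * θ) (by positivity))
    (by positivity : 0 ≤ (j : ℝ) + 1)
  refine le_trans (le_of_eq ?_) this
  ring

theorem mulCosGap_ge (hθ : 0 ≤ θ) :
    powSum k 3 * θ ^ 2 / 2 - powSum k 5 * θ ^ 4 / 24 ≤ mulCosGap k θ := by
  unfold mulCosGap powSum
  simp only [Finset.sum_mul, Finset.sum_div, ← Finset.sum_sub_distrib]
  refine Finset.sum_le_sum fun j _ => ?_
  have := mul_le_mul_of_nonneg_left (cos_le_quartic (x := (j + 1) * θ) (by positivity))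
    (by positivity : 0 ≤ (j : ℝ) + 1)
  refine le_trans (le_of_eq ?_) (sub_le_sub_left this ((j : ℝ) + 1) |>.trans_eq ?_) <;> ring

theorem mulCosGap_le_sextic (hθ : 0 ≤ θ) : mulCosGap k θ ≤
    powSum k 3 * θ ^ 2 / 2 - powSum k 5 * θ ^ 4 / 24 + powSum k 7 * θ ^ 6 / 720 := by
  unfold mulCosGap powSum
  simp only [Finset.sum_mul, Finset.sum_div, ← Finset.sum_sub_distrib, ← Finset.sum_add_distrib]
  refine Finset.sum_le_sum fun j _ => ?_
  have := mul_le_mul_of_nonneg_left (cos_ge_sextic (x := (j + 1) * θ) (by positivity))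
    (by positivity : 0 ≤ (j : ℝ) + 1)
  refine le_trans (le_of_eq ?_) ((sub_le_sub_left this ((j : ℝ) + 1)).trans_eq ?_) <;> ring

theorem mulCosGap_le : mulCosGap k θ ≤ powSum k 3 * θ ^ 2 / 2 := by
  unfold mulCosGap powSum
  simp only [Finset.sum_mul, Finset.sum_div]
  refine Finset.sum_le_sum fun j _ => ?_
  have := mul_le_mul_of_nonneg_left (Real.one_sub_sq_div_two_le_cos (x := (j + 1) * θ))
    (by positivity : 0 ≤ (j : ℝ) + 1)
  refine le_trans (le_of_eq ?_) ((sub_le_sub_left this ((j : ℝ) + 1)).trans_eq ?_) <;> ring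

end PowerSums

section WeightedMoments

open intervalIntegral

variable {G g : ℝ → ℝ} {c T : ℝ}

theorem moment_add_two_le (hT : 0 ≤ T) (hG : ∀ x, HasDerivAt G (g x) x) (hg : Continuous g)
    (hc : ∀ x, 0 ≤ x → x ≤ T → c * x ≤ g x) (p : ℕ) :
    c * ∫ x in (0 : ℝ)..T, Real.exp (-G x) * x ^ (p + 2) ≤
      (p + 1) * ∫ x in (0 : ℝ)..T, Real.exp (-G x) * x ^ p := by
  have hGc : Continuous G := continuous_iff_continuousAt.2 fun x => (hG x).continuousAt
  have hd : ∀ x, HasDerivAt (fun x => Real.exp (-G x) * x ^ (p + 1))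
      ((p + 1) * (Real.exp (-G x) * x ^ p) - g x * (Real.exp (-G x) * x ^ (p + 1))) x := by
    intro x
    have h2 : HasDerivAt (fun x : ℝ => x ^ (p + 1)) ((p + 1) * x ^ p) x := by
      simpa using hasDerivAt_pow (p + 1) x
    exact ((hG x).fun_neg.exp.fun_mul h2).congr_deriv (by ring)
  have hint := integral_eq_sub_of_hasDerivAt (a := 0) (b := T) (fun x _ => hd x)
    ((by fun_prop : Continuous _).intervalIntegrable _ _)
  rw [integral_sub ((by fun_prop : Continuous _).intervalIntegrable _ _)
    ((by fun_prop : Continuous _).intervalIntegrable _ _), integral_const_mul] at hint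
  have hle : c * ∫ x in (0 : ℝ)..T, Real.exp (-G x) * x ^ (p + 2) ≤
      ∫ x in (0 : ℝ)..T, g x * (Real.exp (-G x) * x ^ (p + 1)) := by
    rw [← integral_const_mul]
    refine integral_mono_on hT ((by fun_prop : Continuous _).intervalIntegrable _ _)
      ((by fun_prop : Continuous _).intervalIntegrable _ _) fun x hx => ?_
    calc c * (Real.exp (-G x) * x ^ (p + 2)) = (c * x) * (Real.exp (-G x) * x ^ (p + 1)) := by ring
      _ ≤ _ := mul_le_mul_of_nonneg_right (hc x hx.1 hx.2)
        (mul_nonneg (Real.exp_pos _).le (pow_nonneg hx.1 _))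
  have h0 : 0 ≤ Real.exp (-G T) * T ^ (p + 1) := by positivity
  simp only [ne_eq, Nat.add_eq_zero_iff, one_ne_zero, and_false, not_false_eq_true, zero_pow,
    mul_zero, sub_zero] at hint
  linarith

theorem integral_even_poly_ge (hT : 0 ≤ T) (hG : ∀ x, HasDerivAt G (g x) x) (hg : Continuous g)
    (hc0 : 0 < c) (hc : ∀ x, 0 ≤ x → x ≤ T → c * x ≤ g x) (D : ℝ) {p₄ p₆ p₈ p₁₀ : ℝ}
    (h₄ : 0 ≤ p₄) (h₆ : 0 ≤ p₆) (h₈ : 0 ≤ p₈) (h₁₀ : 0 ≤ p₁₀) :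
    (D - 3 * p₄ / c - 15 * p₆ / c ^ 2 - 105 * p₈ / c ^ 3 - 945 * p₁₀ / c ^ 4) *
      (∫ x in (0 : ℝ)..T, Real.exp (-G x) * x ^ 2) ≤
    ∫ x in (0 : ℝ)..T, Real.exp (-G x) *
      (D * x ^ 2 - p₄ * x ^ 4 - p₆ * x ^ 6 - p₈ * x ^ 8 - p₁₀ * x ^ 10) := by
  have hGc : Continuous G := continuous_iff_continuousAt.2 fun x => (hG x).continuousAt
  have m := moment_add_two_le hT hG hg hc
  have ii : ∀ p : ℕ, IntervalIntegrable (fun x => Real.exp (-G x) * x ^ p)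
    MeasureTheory.volume 0 T := fun p => (by fun_prop : Continuous _).intervalIntegrable _ _
  have e : ∀ x, Real.exp (-G x) *
      (D * x ^ 2 - p₄ * x ^ 4 - p₆ * x ^ 6 - p₈ * x ^ 8 - p₁₀ * x ^ 10) =
      D * (Real.exp (-G x) * x ^ 2) - p₄ * (Real.exp (-G x) * x ^ 4) -
      p₆ * (Real.exp (-G x) * x ^ 6) - p₈ * (Real.exp (-G x) * x ^ 8) -
      p₁₀ * (Real.exp (-G x) * x ^ 10) := fun x => by ring
  simp only [e]
  rw [integral_sub ((((((ii 2).const_mul D).sub ((ii 4).const_mul p₄)).sub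
      ((ii 6).const_mul p₆)).sub ((ii 8).const_mul p₈))) ((ii 10).const_mul p₁₀),
    integral_sub (((((ii 2).const_mul D).sub ((ii 4).const_mul p₄)).sub
      ((ii 6).const_mul p₆))) ((ii 8).const_mul p₈),
    integral_sub ((((ii 2).const_mul D).sub ((ii 4).const_mul p₄))) ((ii 6).const_mul p₆),
    integral_sub ((ii 2).const_mul D) ((ii 4).const_mul p₄)]
  simp only [integral_const_mul]
  generalize hJ2 : (∫ x in (0 : ℝ)..T, Real.exp (-G x) * x ^ 2) = J₂
  have m4 := m 2
  have m6 := m 4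
  have m8 := m 6
  have m10 := m 8
  norm_num only at m4 m6 m8 m10
  rw [hJ2] at m4
  generalize (∫ x in (0 : ℝ)..T, Real.exp (-G x) * x ^ 4) = J₄ at *
  generalize (∫ x in (0 : ℝ)..T, Real.exp (-G x) * x ^ 6) = J₆ at *
  generalize (∫ x in (0 : ℝ)..T, Real.exp (-G x) * x ^ 8) = J₈ at *
  generalize (∫ x in (0 : ℝ)..T, Real.exp (-G x) * x ^ 10) = J₁₀ at *
  have b4 : J₄ ≤ 3 / c * J₂ := by rw [div_mul_eq_mul_div, le_div_iff₀ hc0]; linarith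
  have b6 : J₆ ≤ 15 / c ^ 2 * J₂ := by
    have : J₆ ≤ 5 / c * J₄ := by rw [div_mul_eq_mul_div, le_div_iff₀ hc0]; linarith
    refine this.trans ((mul_le_mul_of_nonneg_left b4 (by positivity)).trans_eq ?_)
    ring
  have b8 : J₈ ≤ 105 / c ^ 3 * J₂ := by
    have : J₈ ≤ 7 / c * J₆ := by rw [div_mul_eq_mul_div, le_div_iff₀ hc0]; linarith
    refine this.trans ((mul_le_mul_of_nonneg_left b6 (by positivity)).trans_eq ?_)
    ring
  have b10 : J₁₀ ≤ 945 / c ^ 4 * J₂ := by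
    have : J₁₀ ≤ 9 / c * J₈ := by rw [div_mul_eq_mul_div, le_div_iff₀ hc0]; linarith
    refine this.trans ((mul_le_mul_of_nonneg_left b8 (by positivity)).trans_eq ?_)
    ring
  have c4 := mul_le_mul_of_nonneg_left b4 h₄
  have c6 := mul_le_mul_of_nonneg_left b6 h₆
  have c8 := mul_le_mul_of_nonneg_left b8 h₈
  have c10 := mul_le_mul_of_nonneg_left b10 h₁₀
  have e : (D - 3 * p₄ / c - 15 * p₆ / c ^ 2 - 105 * p₈ / c ^ 3 - 945 * p₁₀ / c ^ 4) * J₂ =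
    D * J₂ - p₄ * (3 / c * J₂) - p₆ * (15 / c ^ 2 * J₂) - p₈ * (105 / c ^ 3 * J₂) -
      p₁₀ * (945 / c ^ 4 * J₂) := by ring
  rw [e]
  linarith

end WeightedMoments

section PointwiseBound

/-- The coefficient of `cos Y` in the derivative of the comparison function. -/
theorem cos_coeff_bound {V x g h a d c m₄ m₅ m₆ m₇ : ℝ} (hV : 0 < V) (hx : 0 ≤ x) (hd : 0 ≤ d)
    (hg : V * (x - m₄ * x ^ 3) ≤ g) (hg' : g ≤ V * (x - m₄ * x ^ 3 + m₆ * x ^ 5))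
    (hh : V * (a * x ^ 2 - m₅ * x ^ 4) ≤ h) (hh' : h ≤ V * (a * x ^ 2))
    (hh'' : h ≤ V * (a * x ^ 2 - m₅ * x ^ 4 + m₇ * x ^ 6)) :
    |g * (d * x) + (1 - c * x ^ 2) * (d - h) - d - V * ((d - a - c * d / V) * x ^ 2)| ≤
      V * (|a * c - m₄ * d + m₅| * x ^ 4 + (d * m₆ + |c| * m₅ + m₇) * x ^ 6) := by
  have e : g * (d * x) + (1 - c * x ^ 2) * (d - h) - d - V * ((d - a - c * d / V) * x ^ 2) =
      V * (a * c - m₄ * d + m₅) * x ^ 4 + (g - V * (x - m₄ * x ^ 3)) * (d * x) -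
      (h - V * (a * x ^ 2 - m₅ * x ^ 4)) + c * x ^ 2 * (h - V * (a * x ^ 2)) := by
    field_simp
    ring
  have b1 : |V * (a * c - m₄ * d + m₅) * x ^ 4| = V * |a * c - m₄ * d + m₅| * x ^ 4 := by
    rw [abs_mul, abs_mul, abs_of_pos hV, abs_of_nonneg (pow_nonneg hx 4)]
  have hdx : 0 ≤ d * x := mul_nonneg hd hx
  have b2 : (g - V * (x - m₄ * x ^ 3)) * (d * x) ≤ V * (m₆ * x ^ 5) * (d * x) :=
    mul_le_mul_of_nonneg_right (by linarith) hdx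
  have b2' : 0 ≤ (g - V * (x - m₄ * x ^ 3)) * (d * x) := mul_nonneg (by linarith) hdx
  have b3 : |c * x ^ 2 * (h - V * (a * x ^ 2))| ≤ |c| * x ^ 2 * (V * (m₅ * x ^ 4)) := by
    rw [abs_mul, abs_mul, abs_of_nonneg (pow_nonneg hx 2)]
    refine mul_le_mul_of_nonneg_left ?_ (by positivity)
    rw [abs_le]
    constructor <;> linarith
  have b4 : 0 ≤ h - V * (a * x ^ 2 - m₅ * x ^ 4) := by linarith
  have b5 : h - V * (a * x ^ 2 - m₅ * x ^ 4) ≤ V * (m₇ * x ^ 6) := by linarith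
  rw [e, abs_le]
  have := abs_le.1 b1.le
  have := abs_le.1 b3
  have h6 : V * (|a * c - m₄ * d + m₅| * x ^ 4 + (d * m₆ + |c| * m₅ + m₇) * x ^ 6) =
    V * |a * c - m₄ * d + m₅| * x ^ 4 + V * (m₆ * x ^ 5) * (d * x) +
      |c| * x ^ 2 * (V * (m₅ * x ^ 4)) + V * (m₇ * x ^ 6) := by ring
  rw [h6]
  constructor <;> linarith

/-- The coefficient of `sin Y` in the derivative of the comparison function. -/
theorem sin_coeff_bound {V x g h a d c y z m₄ m₅ m₆ m₇ B : ℝ} (hV : 0 < V) (hx : 0 ≤ x)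
    (hd : 0 ≤ d) (hy : 0 ≤ y) (hc : c = a * d - m₄ + y / 24) (hB : B = V + 2 * c - d ^ 2)
    (hB0 : 0 ≤ B)
    (hg : V * (x - m₄ * x ^ 3) ≤ g) (hg' : g ≤ V * (x - m₄ * x ^ 3 + m₆ * x ^ 5))
    (hg'' : V * (x - m₄ * x ^ 3 + m₆ * x ^ 5 - x ^ 7 / 5040) ≤ g)
    (hh : V * (a * x ^ 2 - m₅ * x ^ 4) ≤ h)
    (hh'' : h ≤ V * (a * x ^ 2 - m₅ * x ^ 4 + m₇ * x ^ 6))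
    (hz : x - y * x ^ 3 / 24 ≤ z) (hz' : z ≤ x - y * x ^ 3 / 24 + y ^ 2 * x ^ 5 / 1920) :
    |-g * (1 - c * x ^ 2) - 2 * c * x + d * x * (d - h) + B * z| ≤
      V * (y / 24 * |d ^ 2 - 2 * c| / V * x ^ 3 +
        (|m₄ * c - m₅ * d + m₆| + y ^ 2 * B / (1920 * V)) * x ^ 5 +
        (1 / 5040 + |c| * m₆ + d * m₇) * x ^ 7) := by
  have e : -g * (1 - c * x ^ 2) - 2 * c * x + d * x * (d - h) + B * z =
      y / 24 * (d ^ 2 - 2 * c) * x ^ 3 - V * (m₄ * c - m₅ * d + m₆) * x ^ 5 -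
      (g - V * (x - m₄ * x ^ 3 + m₆ * x ^ 5)) + c * x ^ 2 * (g - V * (x - m₄ * x ^ 3)) -
      d * x * (h - V * (a * x ^ 2 - m₅ * x ^ 4)) + B * (z - (x - y * x ^ 3 / 24)) := by
    rw [hB]
    have : m₄ = a * d + y / 24 - c := by linarith
    rw [this]
    ring
  have b1 : |y / 24 * (d ^ 2 - 2 * c) * x ^ 3| = y / 24 * |d ^ 2 - 2 * c| * x ^ 3 := by
    rw [abs_mul, abs_mul, abs_of_nonneg (pow_nonneg hx 3),
      abs_of_nonneg (by positivity : 0 ≤ y / 24)]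
  have b2 : |V * (m₄ * c - m₅ * d + m₆) * x ^ 5| = V * |m₄ * c - m₅ * d + m₆| * x ^ 5 := by
    rw [abs_mul, abs_mul, abs_of_pos hV, abs_of_nonneg (pow_nonneg hx 5)]
  have b3 : |c * x ^ 2 * (g - V * (x - m₄ * x ^ 3))| ≤ |c| * x ^ 2 * (V * (m₆ * x ^ 5)) := by
    rw [abs_mul, abs_mul, abs_of_nonneg (pow_nonneg hx 2)]
    refine mul_le_mul_of_nonneg_left ?_ (by positivity)
    rw [abs_le]
    constructor <;> linarith
  have hdx : 0 ≤ d * x := mul_nonneg hd hx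
  have b4 : 0 ≤ d * x * (h - V * (a * x ^ 2 - m₅ * x ^ 4)) := mul_nonneg hdx (by linarith)
  have b4' : d * x * (h - V * (a * x ^ 2 - m₅ * x ^ 4)) ≤ d * x * (V * (m₇ * x ^ 6)) :=
    mul_le_mul_of_nonneg_left (by linarith) hdx
  have b5 : 0 ≤ B * (z - (x - y * x ^ 3 / 24)) := mul_nonneg hB0 (by linarith)
  have b5' : B * (z - (x - y * x ^ 3 / 24)) ≤ B * (y ^ 2 * x ^ 5 / 1920) :=
    mul_le_mul_of_nonneg_left (by linarith) hB0
  have h1 := abs_le.1 b1.le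
  have h2 := abs_le.1 b2.le
  have h3 := abs_le.1 b3
  have h6 : V * (y / 24 * |d ^ 2 - 2 * c| / V * x ^ 3 +
        (|m₄ * c - m₅ * d + m₆| + y ^ 2 * B / (1920 * V)) * x ^ 5 +
        (1 / 5040 + |c| * m₆ + d * m₇) * x ^ 7) =
      y / 24 * |d ^ 2 - 2 * c| * x ^ 3 + V * |m₄ * c - m₅ * d + m₆| * x ^ 5 +
      V * (x ^ 7 / 5040) + |c| * x ^ 2 * (V * (m₆ * x ^ 5)) + d * x * (V * (m₇ * x ^ 6)) +
      B * (y ^ 2 * x ^ 5 / 1920) := by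
    field_simp
    ring
  rw [e, h6, abs_le]
  constructor <;> linarith

theorem pointwise_ge {V x z H a d B Sc Cc p c₃ c₅ r₄ r₆ r₇ s : ℝ} (hV : 0 < V) (hx : 0 ≤ x)
    (hd : 0 ≤ d) (ha : 0 ≤ a) (hs : |s| = 1) (hp : 0 ≤ s * p)
    (hS : |Sc + B * z| ≤ V * (c₃ * x ^ 3 + c₅ * x ^ 5 + r₇ * x ^ 7))
    (hC : |Cc - V * (p * x ^ 2)| ≤ V * (r₄ * x ^ 4 + r₆ * x ^ 6))
    (hH : 0 ≤ H) (hH' : H ≤ V * a / 3 * x ^ 3) :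
    V * (s * p * x ^ 2 - (s * p * d ^ 2 / 2 + r₄ + c₃ * d) * x ^ 4 -
      (r₆ + c₃ * (V * a / 3) + c₅ * d) * x ^ 6 -
      (s * p * (V * a / 3) ^ 2 / 2 + c₅ * (V * a / 3) + r₇ * d) * x ^ 8 -
      r₇ * (V * a / 3) * x ^ 10) ≤
    s * (B * z * Real.sin (d * x - H)) +
      s * (Sc * Real.sin (d * x - H) + Cc * Real.cos (d * x - H)) := by
  set Y := d * x - H with hY
  set b := V * a / 3 with hb
  have hdx : 0 ≤ d * x := mul_nonneg hd hx
  have hb0 : 0 ≤ b := by positivity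
  have hbx : 0 ≤ b * x ^ 3 := by positivity
  have hYabs : |Y| ≤ d * x + b * x ^ 3 := by
    rw [abs_le]
    constructor <;> linarith
  have hYsq : Y ^ 2 ≤ d ^ 2 * x ^ 2 + b ^ 2 * x ^ 6 := by
    rcases le_total H (d * x) with h | h
    · have : Y ^ 2 ≤ (d * x) ^ 2 := pow_le_pow_left₀ (by linarith) (by linarith) 2
      nlinarith [sq_nonneg (b * x ^ 3)]
    · have : (H - d * x) ^ 2 ≤ (b * x ^ 3) ^ 2 :=
        pow_le_pow_left₀ (by linarith) (by linarith) 2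
      nlinarith [sq_nonneg (d * x)]
  have hsin : |(Sc + B * z) * Real.sin Y| ≤
      V * (c₃ * x ^ 3 + c₅ * x ^ 5 + r₇ * x ^ 7) * (d * x + b * x ^ 3) := by
    rw [abs_mul]
    exact mul_le_mul hS (Real.abs_sin_le_abs.trans hYabs) (abs_nonneg _)
      ((abs_nonneg _).trans hS)
  have hcos : |(Cc - V * (p * x ^ 2)) * Real.cos Y| ≤ V * (r₄ * x ^ 4 + r₆ * x ^ 6) := by
    rw [abs_mul]
    exact (mul_le_of_le_one_right (abs_nonneg _) (Real.abs_cos_le_one Y)).trans hC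
  have hmain : V * (s * p) * x ^ 2 * (1 - (d ^ 2 * x ^ 2 + b ^ 2 * x ^ 6) / 2) ≤
      V * (s * p) * x ^ 2 * Real.cos Y :=
    mul_le_mul_of_nonneg_left (by linarith [Real.one_sub_sq_div_two_le_cos (x := Y)])
      (by positivity)
  have h1 : -(V * (c₃ * x ^ 3 + c₅ * x ^ 5 + r₇ * x ^ 7) * (d * x + b * x ^ 3)) ≤
      s * ((Sc + B * z) * Real.sin Y) := by
    refine (abs_le.1 (?_ : |s * ((Sc + B * z) * Real.sin Y)| ≤ _)).1
    rwa [abs_mul, hs, one_mul]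
  have h2 : -(V * (r₄ * x ^ 4 + r₆ * x ^ 6)) ≤ s * ((Cc - V * (p * x ^ 2)) * Real.cos Y) := by
    refine (abs_le.1 (?_ : |s * ((Cc - V * (p * x ^ 2)) * Real.cos Y)| ≤ _)).1
    rwa [abs_mul, hs, one_mul]
  have e : s * (B * z * Real.sin Y) + s * (Sc * Real.sin Y + Cc * Real.cos Y) =
      s * ((Sc + B * z) * Real.sin Y) + s * ((Cc - V * (p * x ^ 2)) * Real.cos Y) +
      V * (s * p) * x ^ 2 * Real.cos Y := by ring
  rw [e]
  refine le_trans (le_of_eq ?_) (add_le_add (add_le_add h1 h2) hmain)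
  ring

end PointwiseBound

section LocalIntegral

open intervalIntegral

/-- Lower bound for the central part of the oscillatory integral. -/
theorem local_integral_ge {G g H h z : ℝ → ℝ} {T V γ a d y s c B m₄ m₅ m₆ m₇ : ℝ}
    (hT : 0 ≤ T) (hV : 0 < V) (hγ : 0 < γ) (hd : 0 ≤ d) (ha : 0 ≤ a) (hy : 0 ≤ y)
    (hs : |s| = 1) (hp : 0 ≤ s * (d - a - c * d / V))
    (hm₅ : 0 ≤ m₅) (hm₆ : 0 ≤ m₆) (hm₇ : 0 ≤ m₇)
    (hc : c = a * d - m₄ + y / 24) (hB : B = V + 2 * c - d ^ 2) (hB0 : 0 ≤ B)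
    (hGd : ∀ x, HasDerivAt G (g x) x) (hHd : ∀ x, HasDerivAt H (h x) x)
    (hgc : Continuous g) (hhc : Continuous h) (hzc : Continuous z) (hH0 : H 0 = 0)
    (hγg : ∀ x, 0 ≤ x → x ≤ T → γ * V * x ≤ g x)
    (hg : ∀ x, 0 ≤ x → V * (x - m₄ * x ^ 3) ≤ g x)
    (hg' : ∀ x, 0 ≤ x → g x ≤ V * (x - m₄ * x ^ 3 + m₆ * x ^ 5))
    (hg'' : ∀ x, 0 ≤ x → V * (x - m₄ * x ^ 3 + m₆ * x ^ 5 - x ^ 7 / 5040) ≤ g x)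
    (hh : ∀ x, 0 ≤ x → V * (a * x ^ 2 - m₅ * x ^ 4) ≤ h x)
    (hh' : ∀ x, 0 ≤ x → h x ≤ V * (a * x ^ 2))
    (hh'' : ∀ x, 0 ≤ x → h x ≤ V * (a * x ^ 2 - m₅ * x ^ 4 + m₇ * x ^ 6))
    (hH : ∀ x, 0 ≤ x → 0 ≤ H x) (hH' : ∀ x, 0 ≤ x → H x ≤ V * a / 3 * x ^ 3)
    (hz : ∀ x, 0 ≤ x → x - y * x ^ 3 / 24 ≤ z x)
    (hz' : ∀ x, 0 ≤ x → z x ≤ x - y * x ^ 3 / 24 + y ^ 2 * x ^ 5 / 1920)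
    {D c₃ c₅ r₄ r₆ r₇ : ℝ} (hD : D = s * (d - a - c * d / V))
    (hc₃ : c₃ = y / 24 * |d ^ 2 - 2 * c| / V)
    (hc₅ : c₅ = |m₄ * c - m₅ * d + m₆| + y ^ 2 * B / (1920 * V))
    (hr₄ : r₄ = |a * c - m₄ * d + m₅|) (hr₆ : r₆ = d * m₆ + |c| * m₅ + m₇)
    (hr₇ : r₇ = 1 / 5040 + |c| * m₆ + d * m₇) :
    V * ((D - 3 * (D * d ^ 2 / 2 + r₄ + c₃ * d) / (γ * V) -
        15 * (r₆ + c₃ * (V * a / 3) + c₅ * d) / (γ * V) ^ 2 -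
        105 * (D * (V * a / 3) ^ 2 / 2 + c₅ * (V * a / 3) + r₇ * d) / (γ * V) ^ 3 -
        945 * (r₇ * (V * a / 3)) / (γ * V) ^ 4) *
      ∫ x in (0 : ℝ)..T, Real.exp (-G x) * x ^ 2) -
      Real.exp (-G T) * (1 + |c| * T ^ 2 + d * T) ≤
    s * (B * ∫ x in (0 : ℝ)..T, Real.exp (-G x) * (z x * Real.sin (d * x - H x))) := by
  have hGc : Continuous G := continuous_iff_continuousAt.2 fun x => (hGd x).continuousAt
  have hHc : Continuous H := continuous_iff_continuousAt.2 fun x => (hHd x).continuousAt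
  set Sc : ℝ → ℝ := fun x => -g x * (1 - c * x ^ 2) - 2 * c * x + d * x * (d - h x) with hSc
  set Cc : ℝ → ℝ := fun x => g x * (d * x) + (1 - c * x ^ 2) * (d - h x) - d with hCc
  set F' : ℝ → ℝ := fun x => Real.exp (-G x) *
    (Sc x * Real.sin (d * x - H x) + Cc x * Real.cos (d * x - H x)) with hF'
  have hFd : ∀ x, HasDerivAt (fun x => Real.exp (-G x) * ((1 - c * x ^ 2) *
      Real.sin (d * x - H x) - d * x * Real.cos (d * x - H x))) (F' x) x := by
    intro x
    have hE := (hGd x).fun_neg.exp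
    have hY : HasDerivAt (fun x => d * x - H x) (d - h x) x :=
      (((hasDerivAt_id' x).const_mul d).fun_sub (hHd x)).congr_deriv (by ring)
    have h1 : HasDerivAt (fun x : ℝ => 1 - c * x ^ 2) (-(2 * c * x)) x :=
      (((hasDerivAt_pow 2 x).const_mul c).const_sub 1).congr_deriv (by norm_num; ring)
    have h2 : HasDerivAt (fun x : ℝ => d * x) d x :=
      ((hasDerivAt_id' x).const_mul d).congr_deriv (by ring)
    refine (hE.fun_mul ((h1.fun_mul hY.sin).fun_sub (h2.fun_mul hY.cos))).congr_deriv ?_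
    simp only [hF', hSc, hCc]
    ring
  have hF'c : Continuous F' := by fun_prop
  have hint := integral_eq_sub_of_hasDerivAt (a := 0) (b := T) (fun x _ => hFd x)
    (hF'c.intervalIntegrable _ _)
  simp only [hH0, mul_zero, sub_zero, Real.sin_zero, zero_mul, sub_self] at hint
  have hD0 : 0 ≤ D := hD ▸ hp
  have hc₃0 : 0 ≤ c₃ := by rw [hc₃]; positivity
  have hc₅0 : 0 ≤ c₅ := by rw [hc₅]; positivity
  have hr₄0 : 0 ≤ r₄ := by rw [hr₄]; positivity
  have hr₆0 : 0 ≤ r₆ := by rw [hr₆]; positivity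
  have hr₇0 : 0 ≤ r₇ := by rw [hr₇]; positivity
  have hpoly := integral_even_poly_ge hT hGd hgc (by positivity : 0 < γ * V) hγg D
    (by positivity : 0 ≤ D * d ^ 2 / 2 + r₄ + c₃ * d)
    (by positivity : 0 ≤ r₆ + c₃ * (V * a / 3) + c₅ * d)
    (by positivity : 0 ≤ D * (V * a / 3) ^ 2 / 2 + c₅ * (V * a / 3) + r₇ * d)
    (by positivity : 0 ≤ r₇ * (V * a / 3))
  have hmono : ∫ x in (0 : ℝ)..T, V * (Real.exp (-G x) * (D * x ^ 2 -
      (D * d ^ 2 / 2 + r₄ + c₃ * d) * x ^ 4 - (r₆ + c₃ * (V * a / 3) + c₅ * d) * x ^ 6 -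
      (D * (V * a / 3) ^ 2 / 2 + c₅ * (V * a / 3) + r₇ * d) * x ^ 8 -
      r₇ * (V * a / 3) * x ^ 10)) ≤
      ∫ x in (0 : ℝ)..T, (s * (B * (Real.exp (-G x) * (z x * Real.sin (d * x - H x)))) +
        s * F' x) := by
    refine integral_mono_on hT ((by fun_prop : Continuous _).intervalIntegrable _ _)
      ((by fun_prop : Continuous _).intervalIntegrable _ _) fun x hx => ?_
    have hx0 := hx.1
    have hS := sin_coeff_bound hV hx0 hd hy hc hB hB0 (hg x hx0) (hg' x hx0) (hg'' x hx0)
      (hh x hx0) (hh'' x hx0) (hz x hx0) (hz' x hx0)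
    have hC := cos_coeff_bound (c := c) hV hx0 hd (hg x hx0) (hg' x hx0) (hh x hx0) (hh' x hx0)
      (hh'' x hx0)
    rw [← hc₃, ← hc₅, ← hr₇] at hS
    rw [← hr₄, ← hr₆] at hC
    have := pointwise_ge hV hx0 hd ha hs hp hS hC (hH x hx0) (hH' x hx0)
    rw [← hD] at this
    have := mul_le_mul_of_nonneg_left this (Real.exp_pos (-G x)).le
    refine (le_of_eq ?_).trans (this.trans_eq ?_)
    · ring
    · simp only [hF', hSc, hCc]
      ring
  rw [integral_const_mul, integral_add ((by fun_prop : Continuous _).intervalIntegrable _ _)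
    ((by fun_prop : Continuous _).intervalIntegrable _ _), integral_const_mul, integral_const_mul,
    integral_const_mul, hint] at hmono
  have hFT : s * (Real.exp (-G T) * ((1 - c * T ^ 2) * Real.sin (d * T - H T) -
      d * T * Real.cos (d * T - H T))) ≤ Real.exp (-G T) * (1 + |c| * T ^ 2 + d * T) := by
    refine (le_abs_self _).trans ?_
    rw [abs_mul, hs, one_mul, abs_mul, abs_of_pos (Real.exp_pos _)]
    refine mul_le_mul_of_nonneg_left ?_ (Real.exp_pos _).le
    refine (abs_sub _ _).trans (add_le_add ?_ ?_)
    · rw [abs_mul]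
      refine (mul_le_of_le_one_right (abs_nonneg _) (Real.abs_sin_le_one _)).trans ?_
      refine (abs_sub _ _).trans ?_
      rw [abs_mul, abs_one, abs_of_nonneg (sq_nonneg T)]
    · rw [abs_mul, abs_of_nonneg (mul_nonneg hd hT)]
      exact mul_le_of_le_one_right (mul_nonneg hd hT) (Real.abs_cos_le_one _)
  have := mul_le_mul_of_nonneg_left hpoly hV.le
  linarith

end LocalIntegral

section CoefficientBounds

variable {y w a e d c m₄ m₅ m₆ m₇ : ℝ}

theorem abs_cos_coeff_le (hy : 0 ≤ y) (hy' : y ≤ 4 / 25) (hw : w = 1 - y / 4) (ha : a = 3 * w / 8)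
    (hd : d = a + e) (hm₄ : m₄ = (3 * w - y) / 30)
    (hm₅ : m₅ = w * (2 * w - y) / 96)
    (hc : c = a * d - m₄ + y / 24) :
    |a * c - m₄ * d + m₅| ≤ 0.00145 + 0.041 * |e| := by
  have hy2 : y ^ 2 ≤ 4 / 25 * y := by nlinarith
  have hy3 : y ^ 3 ≤ 4 / 25 * y ^ 2 := by nlinarith [sq_nonneg y]
  have hy2' := sq_nonneg y
  have hy3' := pow_nonneg hy 3
  have h1 : a * c - m₄ * d + m₅ =
      ((-11/7680) + (109/6144) * y + (-43/40960) * y ^ 2 + (-27/32768) * y ^ 3) +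
      ((13/320) + (-23/1920) * y + (9/1024) * y ^ 2) * e := by
    rw [hc, hd, hm₅, hm₄, ha, hw]; ring
  have hP : |(-11/7680) + (109/6144) * y + (-43/40960) * y ^ 2 + (-27/32768) * y ^ 3| ≤
      0.00145 := by
    rw [abs_le]; constructor <;> linarith
  have hQ : |(13/320) + (-23/1920) * y + (9/1024) * y ^ 2| ≤ 0.041 := by
    rw [abs_le]; constructor <;> linarith
  rw [h1]
  refine (abs_add_le _ _).trans (add_le_add hP ?_)
  rw [abs_mul]
  exact mul_le_mul_of_nonneg_right hQ (abs_nonneg e)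

theorem abs_sin_coeff_le (hy : 0 ≤ y) (hy' : y ≤ 4 / 25) (hw : w = 1 - y / 4) (ha : a = 3 * w / 8)
    (hd : d = a + e) (hm₄ : m₄ = (3 * w - y) / 30)
    (hm₅ : m₅ = w * (2 * w - y) / 96)
    (hm₆ : m₆ = (3 * w ^ 2 - 3 * w * y + y ^ 2) / 840)
    (hc : c = a * d - m₄ + y / 24) :
    |m₄ * c - m₅ * d + m₆| ≤ 0.00018 + 0.005 * y + 0.017 * |e| := by
  have hy2 : y ^ 2 ≤ 4 / 25 * y := by nlinarith
  have hy3 : y ^ 3 ≤ 4 / 25 * y ^ 2 := by nlinarith [sq_nonneg y]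
  have hy2' := sq_nonneg y
  have hy3' := pow_nonneg hy 3
  have h1 : m₄ * c - m₅ * d + m₆ =
      ((-1/5600) + (673/134400) * y + (-11/5600) * y ^ 2 + (-3/20480) * y ^ 3) +
      ((1/60) + (-1/96) * y + (1/640) * y ^ 2) * e := by
    rw [hc, hd, hm₆, hm₅, hm₄, ha, hw]; ring
  have hP : |(-1/5600) + (673/134400) * y + (-11/5600) * y ^ 2 + (-3/20480) * y ^ 3| ≤
      0.00018 + 0.005 * y := by
    rw [abs_le]; constructor <;> linarith
  have hQ : |(1/60) + (-1/96) * y + (1/640) * y ^ 2| ≤ 0.017 := by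
    rw [abs_le]; constructor <;> linarith
  rw [h1]
  refine (abs_add_le _ _).trans (add_le_add hP ?_)
  rw [abs_mul]
  exact mul_le_mul_of_nonneg_right hQ (abs_nonneg e)

theorem coeff_bounds (hy : 0 ≤ y) (hy' : y ≤ 4 / 25) (hw : w = 1 - y / 4) (ha : a = 3 * w / 8)
    (he : |e| ≤ 2 / 5) (hd : d = a + e) (hd0 : 0 ≤ d)
    (hm₄ : m₄ = (3 * w - y) / 30) (hm₅ : m₅ = w * (2 * w - y) / 96)
    (hm₆ : m₆ = (3 * w ^ 2 - 3 * w * y + y ^ 2) / 840)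
    (hm₇ : m₇ = w * (3 * w ^ 2 - 4 * w * y + 2 * y ^ 2) / 5760)
    (hc : c = a * d - m₄ + y / 24) :
    (0 ≤ m₅ ∧ 0 ≤ m₆ ∧ 0 ≤ m₇) ∧
    d ≤ 0.375 + |e| ∧ |c| ≤ 0.0456 + 0.375 * |e| ∧
    |a * c - m₄ * d + m₅| ≤ 0.00145 + 0.041 * |e| ∧
    |m₄ * c - m₅ * d + m₆| ≤ 0.00018 + 0.005 * y + 0.017 * |e| ∧
    d * m₆ + |c| * m₅ + m₇ ≤ 0.00283 + 0.0114 * |e| ∧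
    1 / 5040 + |c| * m₆ + d * m₇ ≤ 0.00057 + 0.0019 * |e| ∧
    |d ^ 2 - 2 * c| ≤ 0.232 + 1.9 * |e| := by
  have he0 := abs_nonneg e
  have hle := le_abs_self e
  have hle' := neg_abs_le e
  have hm5 : 0 ≤ m₅ := by rw [hm₅, hw]; nlinarith
  have hm6 : 0 ≤ m₆ := by rw [hm₆, hw]; nlinarith
  have hm7 : 0 ≤ m₇ := by
    rw [hm₇]
    have : 0 ≤ 3 * w ^ 2 - 4 * w * y + 2 * y ^ 2 := by nlinarith [sq_nonneg (w - y)]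
    have : 0 ≤ w := by linarith
    positivity
  have hm5' : m₅ ≤ 1 / 48 := by rw [hm₅, hw]; nlinarith
  have hm6' : m₆ ≤ 1 / 280 := by rw [hm₆, hw]; nlinarith
  have hm7' : m₇ ≤ 1 / 1920 := by
    rw [hm₇]
    have h1 : 3 * w ^ 2 - 4 * w * y + 2 * y ^ 2 ≤ 3 := by rw [hw]; nlinarith
    have h2 : w * (3 * w ^ 2 - 4 * w * y + 2 * y ^ 2) ≤ 1 * 3 :=
      mul_le_mul (by linarith) h1 (by nlinarith [sq_nonneg (w - y)]) one_pos.le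
    linarith
  have hd' : d ≤ 0.375 + |e| := by rw [hd, ha]; linarith
  have ha1 : a ≤ 0.375 := by rw [ha]; linarith
  have ha0 : 0 ≤ a := by rw [ha]; linarith
  have hc_eq : c = (0.040625 + 0.0296875 * y + 0.0087890625 * y ^ 2) + a * e := by
    rw [hc, hd, hm₄, ha, hw]; ring
  have hae : |a * e| ≤ 0.375 * |e| := by
    rw [abs_mul, abs_of_nonneg ha0]; exact mul_le_mul_of_nonneg_right ha1 he0
  have hae' := abs_le.1 hae
  have hc' : |c| ≤ 0.0456 + 0.375 * |e| := by
    rw [hc_eq, abs_le]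
    constructor <;> linarith [sq_nonneg y, (by nlinarith : y ^ 2 ≤ 4 / 25 * y)]
  refine ⟨⟨hm5, hm6, hm7⟩, hd', hc', ?_, ?_, ?_, ?_, ?_⟩
  · exact abs_cos_coeff_le hy hy' hw ha hd hm₄ hm₅ hc
  · exact abs_sin_coeff_le hy hy' hw ha hd hm₄ hm₅ hm₆ hc
  · linarith [mul_le_mul hd' hm6' hm6 (by positivity), mul_le_mul hc' hm5' hm5 (by positivity)]
  · linarith [mul_le_mul hd' hm7' hm7 (by positivity), mul_le_mul hc' hm6' hm6 (by positivity)]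
  · have h1 : d ^ 2 ≤ (0.375 + |e|) * (0.375 + |e|) := by
      rw [sq]; exact mul_le_mul hd' hd' hd0 (by positivity)
    have h2 := abs_le.1 hc'
    have h3 : |e| * |e| ≤ 2 / 5 * |e| := mul_le_mul_of_nonneg_right he he0
    have h4 : 0 ≤ d ^ 2 := sq_nonneg d
    rw [abs_le]
    constructor <;> linarith

end CoefficientBounds

section Margin

theorem margin_mono {D D₀ ε ε₀ d d₀ a a₀ γ c₃ c₃' c₅ c₅' r₄ r₄' r₆ r₆' r₇ r₇' : ℝ} (hγ : 0 < γ)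
    (hD₀ : 0 ≤ D₀) (hD : D₀ ≤ D) (hε : 0 ≤ ε) (hε₀ : ε ≤ ε₀) (hd : 0 ≤ d) (hd₀ : d ≤ d₀)
    (ha : 0 ≤ a) (ha₀ : a ≤ a₀) (hc₃ : 0 ≤ c₃) (hc₃' : c₃ ≤ c₃') (hc₅ : 0 ≤ c₅) (hc₅' : c₅ ≤ c₅')
    (hr₄' : r₄ ≤ r₄') (hr₆ : 0 ≤ r₆) (hr₆' : r₆ ≤ r₆') (hr₇ : 0 ≤ r₇) (hr₇' : r₇ ≤ r₇')
    (hl : 0 ≤ 1 - ε₀ * (3 / 2 * d₀ ^ 2 + 35 / 6 * a₀ ^ 2 / γ ^ 2)) :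
    D₀ * (1 - ε₀ * (3 / 2 * d₀ ^ 2 + 35 / 6 * a₀ ^ 2 / γ ^ 2)) - 3 * (r₄' + c₃' * d₀) -
      15 * ε₀ * (r₆' + c₅' * d₀) - 5 * c₃' * a₀ / γ - 35 * c₅' * a₀ * ε₀ / γ -
      105 * r₇' * d₀ * ε₀ ^ 2 - 315 * r₇' * a₀ * ε₀ ^ 2 / γ ≤
    D * (1 - ε * (3 / 2 * d ^ 2 + 35 / 6 * a ^ 2 / γ ^ 2)) - 3 * (r₄ + c₃ * d) -
      15 * ε * (r₆ + c₅ * d) - 5 * c₃ * a / γ - 35 * c₅ * a * ε / γ -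
      105 * r₇ * d * ε ^ 2 - 315 * r₇ * a * ε ^ 2 / γ := by
  have hε₀0 : 0 ≤ ε₀ := hε.trans hε₀
  have hd₀0 : 0 ≤ d₀ := hd.trans hd₀
  have ha₀0 : 0 ≤ a₀ := ha.trans ha₀
  have hc₃'0 : 0 ≤ c₃' := hc₃.trans hc₃'
  have hc₅'0 : 0 ≤ c₅' := hc₅.trans hc₅'
  have hr₇'0 : 0 ≤ r₇' := hr₇.trans hr₇'
  have h0 : ε * (3 / 2 * d ^ 2 + 35 / 6 * a ^ 2 / γ ^ 2) ≤
      ε₀ * (3 / 2 * d₀ ^ 2 + 35 / 6 * a₀ ^ 2 / γ ^ 2) := by gcongr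
  have h1 : D₀ * (1 - ε₀ * (3 / 2 * d₀ ^ 2 + 35 / 6 * a₀ ^ 2 / γ ^ 2)) ≤
      D * (1 - ε * (3 / 2 * d ^ 2 + 35 / 6 * a ^ 2 / γ ^ 2)) :=
    mul_le_mul hD (by linarith) hl (by linarith)
  have h2 : 3 * (r₄ + c₃ * d) ≤ 3 * (r₄' + c₃' * d₀) := by
    have : c₃ * d ≤ c₃' * d₀ := mul_le_mul hc₃' hd₀ hd (by linarith)
    linarith
  have h3 : 15 * ε * (r₆ + c₅ * d) ≤ 15 * ε₀ * (r₆' + c₅' * d₀) := by gcongr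
  have h4 : 5 * c₃ * a / γ ≤ 5 * c₃' * a₀ / γ := by gcongr
  have h5 : 35 * c₅ * a * ε / γ ≤ 35 * c₅' * a₀ * ε₀ / γ := by gcongr
  have h6 : 105 * r₇ * d * ε ^ 2 ≤ 105 * r₇' * d₀ * ε₀ ^ 2 := by gcongr
  have h7 : 315 * r₇ * a * ε ^ 2 / γ ≤ 315 * r₇' * a₀ * ε₀ ^ 2 / γ := by gcongr
  linarith

theorem margin_eq {V γ D d a c₃ c₅ r₄ r₆ r₇ : ℝ} (hV : 0 < V) (hγ : 0 < γ) :
    γ * (V * (D - 3 * (D * d ^ 2 / 2 + r₄ + c₃ * d) / (γ * V) -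
        15 * (r₆ + c₃ * (V * a / 3) + c₅ * d) / (γ * V) ^ 2 -
        105 * (D * (V * a / 3) ^ 2 / 2 + c₅ * (V * a / 3) + r₇ * d) / (γ * V) ^ 3 -
        945 * (r₇ * (V * a / 3)) / (γ * V) ^ 4)) =
    (γ * (V * D)) * (1 - 1 / (γ * V) * (3 / 2 * d ^ 2 + 35 / 6 * a ^ 2 / γ ^ 2)) -
      3 * (r₄ + c₃ * d) -
      15 * (1 / (γ * V)) * (r₆ + c₅ * d) - 5 * c₃ * a / γ - 35 * c₅ * a * (1 / (γ * V)) / γ -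
      105 * r₇ * d * (1 / (γ * V)) ^ 2 - 315 * r₇ * a * (1 / (γ * V)) ^ 2 / γ := by
  field_simp
  ring

variable {x y w a e δ d c m₄ m₅ m₆ m₇ V s : ℝ}

/-- Lower bound for the leading coefficient. -/
theorem leading_coeff_ge (hx : 0 < x) (hx' : x ≤ 2 / 5) (hy : y = x ^ 2) (hw : w = 1 - y / 4)
    (ha : a = 3 * w / 8) (he : e = δ * x) (hd : d = a + e) (hd0 : 0 ≤ d)
    (hm₄ : m₄ = (3 * w - y) / 30) (hc : c = a * d - m₄ + y / 24)
    (hV : 41 * w / 3 ≤ V) (hVx : 2 * w / 3 ≤ V * x)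
    (hδ : (s = 1 ∧ 1 / 16 + 3 * x / 32 ≤ δ ∧ δ ≤ 1) ∨ (s = -1 ∧ -1 ≤ δ ∧ δ ≤ -1 / 19)) :
    |e| ≤ 2 / 5 ∧ 12.7 * |e| - 0.0172 ≤ s * (e * V - c * d) ∧
      (|e| ≤ 0.006 → y ≤ 0.0135 ∧ 0.0264 ≤ s * (e * V - c * d)) := by
  have hy0 : 0 ≤ y := hy ▸ sq_nonneg x
  have hy1 : y ≤ 4 / 25 := by rw [hy]; nlinarith only [hx, hx']
  have hV1 : 13.12 ≤ V := by rw [hw] at hV; linarith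
  have ha1 : a ≤ 0.375 := by rw [ha]; linarith
  have ha0 : 0.36 ≤ a := by rw [ha]; linarith
  have hc_eq : c = (0.040625 + 0.0296875 * y + 0.0087890625 * y ^ 2) + a * e := by
    rw [hc, hd, hm₄, ha, hw]; ring
  have hy2 : y ^ 2 ≤ 4 / 25 * y := by nlinarith only [hy0, hy1]
  set c₀ := 0.040625 + 0.0296875 * y + 0.0087890625 * y ^ 2 with hc₀
  have hc₀1 : c₀ ≤ 0.040625 + 0.0312 * y := by linarith
  have hc₀0 : 0.040625 ≤ c₀ := by linarith [sq_nonneg y]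
  have hcd : c * d = a * c₀ + e * (c₀ + a ^ 2) + a * e ^ 2 := by rw [hc_eq, hd]; ring
  have hasq : a ^ 2 ≤ 0.375 ^ 2 := pow_le_pow_left₀ (by linarith) ha1 2
  have hac : a * c₀ ≤ 0.375 * (0.040625 + 0.0312 * y) :=
    mul_le_mul ha1 hc₀1 (by linarith) (by norm_num)
  rcases hδ with ⟨rfl, hδ, hδ1⟩ | ⟨rfl, hδ1, hδ⟩
  · have hδ0 : 0 < δ := by linarith
    have he0 : 0 < e := he ▸ mul_pos hδ0 hx
    have he1 : e ≤ 2 / 5 := by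
      rw [he]; linarith [mul_le_mul_of_nonneg_right hδ1 hx.le]
    rw [abs_of_pos he0, one_mul, hcd]
    refine ⟨he1, ?_, fun h => ?_⟩
    · have h1 : e * 13.12 ≤ e * V := mul_le_mul_of_nonneg_left hV1 he0.le
      have h2 : e * (c₀ + a ^ 2) ≤ e * 0.187 := mul_le_mul_of_nonneg_left (by linarith) he0.le
      have h3 : a * e ^ 2 ≤ 0.15 * e := by
        have : a * e ≤ 0.375 * (2 / 5) := mul_le_mul ha1 he1 he0.le (by norm_num)
        linarith [mul_le_mul_of_nonneg_right this he0.le]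
      linarith
    · have hxs : x ≤ 0.09 := by
        by_contra! h1
        have h2 : (1 / 16 + 3 * 0.09 / 32) * 0.09 ≤ δ * x :=
          mul_le_mul (by linarith) h1.le (by norm_num) hδ0.le
        rw [← he] at h2
        norm_num at h2
        linarith
      have hys : y ≤ 0.0081 := by rw [hy]; nlinarith only [hx, hxs]
      refine ⟨by linarith, ?_⟩
      have h1 : e * (c₀ + a ^ 2) + a * e ^ 2 ≤ e * 0.185 := by
        have h2 : a * e ≤ 0.375 * 0.006 := mul_le_mul ha1 h he0.le (by norm_num)
        have h3 : e * (c₀ + a ^ 2 + a * e) ≤ e * 0.185 :=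
          mul_le_mul_of_nonneg_left (by linarith) he0.le
        linarith
      have h2 : (1 / 16 + 3 * x / 32) * (2 * w / 3 - 0.185 * x) ≤ δ * (V * x - 0.185 * x) :=
        mul_le_mul hδ (by linarith) (by rw [hw]; linarith) hδ0.le
      have h3 : e * V - e * 0.185 = δ * (V * x - 0.185 * x) := by rw [he]; ring
      have h4 : 0.04165 ≤ (1 / 16 + 3 * x / 32) * (2 * w / 3 - 0.185 * x) - 0.0312 * y := by
        rw [hw, hy]; nlinarith only [pow_pos hx 3, hx, hxs]
      linarith
  · have hδ0 : δ < 0 := by linarith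
    have he0 : e < 0 := he ▸ mul_neg_of_neg_of_pos hδ0 hx
    have he1 : -(2 / 5) ≤ e := by
      rw [he]; linarith [mul_le_mul_of_nonneg_right hδ1 hx.le]
    rw [abs_of_neg he0]
    refine ⟨by linarith, ?_, fun h => ?_⟩
    · have hcd' : -(0.15 * (-e)) ≤ c * d := by
        have h1 : a * e ≤ c := by rw [hc_eq]; linarith
        have h2 : (a * e) * d ≤ c * d := mul_le_mul_of_nonneg_right h1 hd0
        have h3 : d ≤ 0.375 := by linarith
        have h4 : a * d ≤ 0.375 * 0.375 := mul_le_mul ha1 h3 hd0 (by norm_num)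
        have h5 : a * d * (-e) ≤ 0.375 * 0.375 * (-e) :=
          mul_le_mul_of_nonneg_right h4 (by linarith)
        linarith
      have h6 : -e * 13.12 ≤ -e * V := mul_le_mul_of_nonneg_left hV1 (by linarith)
      linarith
    · have hxs : x ≤ 0.115 := by
        have h1 : x * (1 / 19) ≤ x * -δ := mul_le_mul_of_nonneg_left (by linarith) hx.le
        linarith
      have hys : y ≤ 0.0135 := by rw [hy]; nlinarith only [hx, hxs]
      refine ⟨hys, ?_⟩
      have h1 : 0 ≤ c * d := by
        refine mul_nonneg ?_ hd0
        rw [hc_eq]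
        have h2 : a * -e ≤ 0.375 * 0.006 := mul_le_mul ha1 h (by linarith) (by norm_num)
        linarith
      have h2 : 1 / 19 * (2 * w / 3) ≤ -δ * (V * x) :=
        mul_le_mul (by linarith) hVx (by rw [hw]; linarith) (by linarith)
      have h3 : -1 * (e * V - c * d) = -δ * (V * x) + c * d := by rw [he]; ring
      rw [h3]
      rw [hw] at h2
      linarith

theorem margin_linear_ge {E : ℝ} (hE : 0.006 ≤ E) :
    0.001725 ≤ 0.69 * (12.7 * E - 0.0172) *
      (1 - 0.1105 * (3 / 2 * 0.775 ^ 2 + 35 / 6 * 0.375 ^ 2 / 0.69 ^ 2)) -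
      3 * (0.00145 + 0.041 * E + 0.00051 * (0.232 + 1.9 * E) * 0.775) -
      15 * 0.1105 * (0.00283 + 0.0114 * E + (0.001 + 0.017 * E) * 0.775) -
      5 * (0.00051 * (0.232 + 1.9 * E)) * 0.375 / 0.69 -
      35 * (0.001 + 0.017 * E) * 0.375 * 0.1105 / 0.69 -
      105 * (0.00057 + 0.0019 * E) * 0.775 * 0.1105 ^ 2 -
      315 * (0.00057 + 0.0019 * E) * 0.375 * 0.1105 ^ 2 / 0.69 := by
  norm_num1
  linarith

set_option maxHeartbeats 600000 in
/-- The main term of the local estimate is bounded below by a positive constant. -/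
theorem margin_pos {D B c₃ c₅ r₄ r₆ r₇ : ℝ} (hx : 0 < x) (hx' : x ≤ 2 / 5) (hy : y = x ^ 2)
    (hw : w = 1 - y / 4) (ha : a = 3 * w / 8) (he : e = δ * x) (hd : d = a + e) (hd0 : 0 ≤ d)
    (hm₄ : m₄ = (3 * w - y) / 30) (hm₅ : m₅ = w * (2 * w - y) / 96)
    (hm₆ : m₆ = (3 * w ^ 2 - 3 * w * y + y ^ 2) / 840)
    (hm₇ : m₇ = w * (3 * w ^ 2 - 4 * w * y + 2 * y ^ 2) / 5760)
    (hc : c = a * d - m₄ + y / 24) (hV : 41 * w / 3 ≤ V) (hVx : 2 * w / 3 ≤ V * x)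
    (hδ : (s = 1 ∧ 1 / 16 + 3 * x / 32 ≤ δ ∧ δ ≤ 1) ∨ (s = -1 ∧ -1 ≤ δ ∧ δ ≤ -1 / 19))
    (hB : B = V + 2 * c - d ^ 2) (hD : D = s * (d - a - c * d / V))
    (hc₃ : c₃ = y / 24 * |d ^ 2 - 2 * c| / V)
    (hc₅ : c₅ = |m₄ * c - m₅ * d + m₆| + y ^ 2 * B / (1920 * V))
    (hr₄ : r₄ = |a * c - m₄ * d + m₅|) (hr₆ : r₆ = d * m₆ + |c| * m₅ + m₇)
    (hr₇ : r₇ = 1 / 5040 + |c| * m₆ + d * m₇) :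
    0 ≤ D ∧ 0 ≤ B ∧ B ≤ 1.1 * V ∧ |c| ≤ 0.2 ∧ d ≤ 0.775 ∧ 0 ≤ m₅ ∧ 0 ≤ m₆ ∧ 0 ≤ m₇ ∧
    0.0025 ≤ V * (D - 3 * (D * d ^ 2 / 2 + r₄ + c₃ * d) / (0.69 * V) -
        15 * (r₆ + c₃ * (V * a / 3) + c₅ * d) / (0.69 * V) ^ 2 -
        105 * (D * (V * a / 3) ^ 2 / 2 + c₅ * (V * a / 3) + r₇ * d) / (0.69 * V) ^ 3 -
        945 * (r₇ * (V * a / 3)) / (0.69 * V) ^ 4) := by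
  obtain ⟨he1, hlead, hlead'⟩ := leading_coeff_ge hx hx' hy hw ha he hd hd0 hm₄ hc hV hVx hδ
  have hy0 : 0 ≤ y := hy ▸ sq_nonneg x
  have hy1 : y ≤ 4 / 25 := by rw [hy]; nlinarith only [hx, hx']
  obtain ⟨⟨hm₅0, hm₆0, hm₇0⟩, b1, b2, b3, b4, b5, b6, b7⟩ :=
    coeff_bounds hy0 hy1 hw ha he1 hd hd0 hm₄ hm₅ hm₆ hm₇ hc
  have hV1 : 13.12 ≤ V := by rw [hw] at hV; linarith
  have hV0 : 0 < V := by linarith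
  have ha1 : a ≤ 0.375 := by rw [ha]; linarith
  have ha0 : 0 ≤ a := by rw [ha]; linarith
  have hBabs := abs_le.1 (b7.trans (by linarith : 0.232 + 1.9 * |e| ≤ 0.992))
  have hB0 : 0 ≤ B := by linarith [hBabs.2]
  have hB1 : B ≤ 1.1 * V := by linarith [hBabs.1]
  have hVD : V * D = s * (e * V - c * d) := by
    rw [hD, hd]; field_simp; ring
  have habs := abs_nonneg e
  have hVD0 : 0 ≤ V * D := by
    rw [hVD]
    rcases le_total |e| 0.006 with h | h
    · linarith [(hlead' h).2]
    · linarith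
  have hD0 : 0 ≤ D := by
    rw [mul_comm] at hVD0; exact nonneg_of_mul_nonneg_left hVD0 hV0
  have hc₃0 : 0 ≤ c₃ := by rw [hc₃]; positivity
  have hc₅0 : 0 ≤ c₅ := by rw [hc₅]; positivity
  have hr₆0 : 0 ≤ r₆ := by rw [hr₆]; positivity
  have hr₇0 : 0 ≤ r₇ := by rw [hr₇]; positivity
  have hBV : y ^ 2 * B / (1920 * V) ≤ y * (y * 0.0006) := by
    rw [div_le_iff₀ (by positivity)]
    have : B ≤ 0.0006 * (1920 * V) := by linarith
    linarith [mul_le_mul_of_nonneg_left this (sq_nonneg y)]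
  refine ⟨hD0, hB0, hB1, by linarith, by linarith, hm₅0, hm₆0, hm₇0, ?_⟩
  have key := margin_eq (D := D) (d := d) (a := a) (c₃ := c₃) (c₅ := c₅) (r₄ := r₄) (r₆ := r₆)
    (r₇ := r₇) hV0 (by norm_num : (0 : ℝ) < 0.69)
  suffices h : 0.001725 ≤ 0.69 * (V * (D - 3 * (D * d ^ 2 / 2 + r₄ + c₃ * d) / (0.69 * V) -
        15 * (r₆ + c₃ * (V * a / 3) + c₅ * d) / (0.69 * V) ^ 2 -
        105 * (D * (V * a / 3) ^ 2 / 2 + c₅ * (V * a / 3) + r₇ * d) / (0.69 * V) ^ 3 -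
        945 * (r₇ * (V * a / 3)) / (0.69 * V) ^ 4)) by linarith
  rw [key, hVD]
  have hε0 : 0 ≤ 1 / (0.69 * V) := by positivity
  rcases le_total |e| 0.006 with h | h
  · obtain ⟨hys, hlead⟩ := hlead' h
    have hV2 : 13.62 ≤ V := by rw [hw] at hV; linarith
    refine le_trans ?_ (margin_mono (by norm_num) (D₀ := 0.69 * 0.0264) (by norm_num) (by linarith)
      hε0 (ε₀ := 0.1066) ?_ hd0 (d₀ := 0.381) (by linarith) ha0 ha1 hc₃0 (c₃' := 0.0000102) ?_
      hc₅0 (c₅' := 0.00036) ?_ (r₄' := 0.0017) (by linarith) hr₆0 (r₆' := 0.0029) (by linarith)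
      hr₇0 (r₇' := 0.00059) (by linarith) (by norm_num))
    · norm_num
    · rw [div_le_iff₀ (by positivity)]; linarith
    · rw [hc₃, div_le_iff₀ hV0]
      have : y / 24 * |d ^ 2 - 2 * c| ≤ 0.0135 / 24 * 0.2434 :=
        mul_le_mul (by linarith) (by linarith) (abs_nonneg _) (by norm_num)
      linarith
    · have : y * (y * 0.0006) ≤ 0.0135 * (0.0135 * 0.0006) := by gcongr
      rw [hc₅]; linarith
  · refine le_trans ?_ (margin_mono (by norm_num) (D₀ := 0.69 * (12.7 * |e| - 0.0172))
      (by linarith) (by linarith)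
      hε0 (ε₀ := 0.1105) ?_ hd0 (d₀ := 0.775) (by linarith) ha0 ha1 hc₃0
      (c₃' := 0.00051 * (0.232 + 1.9 * |e|)) ?_
      hc₅0 (c₅' := 0.001 + 0.017 * |e|) ?_
      (r₄' := 0.00145 + 0.041 * |e|) (hr₄ ▸ b3) hr₆0 (r₆' := 0.00283 + 0.0114 * |e|) (by linarith)
      hr₇0 (r₇' := 0.00057 + 0.0019 * |e|) (by linarith) (by norm_num))
    · exact margin_linear_ge h
    · rw [div_le_iff₀ (by positivity)]; linarith
    · rw [hc₃, div_le_iff₀ hV0]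
      have : y / 24 * |d ^ 2 - 2 * c| ≤ 0.16 / 24 * (0.232 + 1.9 * |e|) :=
        mul_le_mul (by linarith) b7 (abs_nonneg _) (by norm_num)
      have h2 : 0.00051 * (0.232 + 1.9 * |e|) * 13.12 ≤ 0.00051 * (0.232 + 1.9 * |e|) * V :=
        mul_le_mul_of_nonneg_left hV1 (by positivity)
      linarith
    · have : y * (y * 0.0006) ≤ 0.16 * (0.16 * 0.0006) := by
        have : y ≤ 0.16 := by linarith
        gcongr
      rw [hc₅]; linarith

end Margin

section Rescaling

open intervalIntegral

variable {k : ℕ} {lam K x y w V : ℝ}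

theorem lam_mul_powSum_eq (hK : K = k + 1 / 2) (hx : x * K = 1) (hy : y = x ^ 2)
    (hw : w = 1 - y / 4) (hV : V = lam * K * w / 3) :
    lam * powSum k 2 * x ^ 2 = V ∧ lam * powSum k 3 * x ^ 3 / 2 = V * (3 * w / 8) ∧
    lam * powSum k 4 * x ^ 4 / 6 = V * ((3 * w - y) / 30) ∧
    lam * powSum k 5 * x ^ 5 / 24 = V * (w * (2 * w - y) / 96) ∧
    lam * powSum k 6 * x ^ 6 / 120 = V * ((3 * w ^ 2 - 3 * w * y + y ^ 2) / 840) ∧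
    lam * powSum k 7 * x ^ 7 / 720 = V * (w * (3 * w ^ 2 - 4 * w * y + 2 * y ^ 2) / 5760) := by
  have hK0 : K ≠ 0 := fun h => by simp [h] at hx
  have hxe : x = 1 / K := by field_simp; exact hx
  have hq : (k : ℝ) * (k + 1) = K ^ 2 - 1 / 4 := by rw [hK]; ring
  have hwe : w = (K ^ 2 - 1 / 4) / K ^ 2 := by rw [hw, hy, hxe]; field_simp
  rw [powSum_six, powSum_four, powSum_two, powSum_three, powSum_five, powSum_seven, hq, ← hK, hV,
    hwe, hy, hxe]
  refine ⟨?_, ?_, ?_, ?_, ?_, ?_⟩ <;> field_simp <;> ring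

theorem lam_mul_powSum_eight_le (hl : 0 ≤ lam) (hK : K = k + 1 / 2) (hx : x * K = 1)
    (hx0 : 0 < x) (hV : lam * powSum k 2 * x ^ 2 = V) : lam * powSum k 8 * x ^ 8 ≤ V := by
  have h := powSum_eight_le k
  rw [← hK] at h
  calc lam * powSum k 8 * x ^ 8 ≤ lam * (powSum k 2 * K ^ 6) * x ^ 8 := by gcongr
    _ = lam * powSum k 2 * x ^ 2 * (x * K) ^ 6 := by ring
    _ = V := by rw [hx, hV]; ring

/-- The local part of the Fourier integral, in rescaled variables. -/
theorem rescaled_local_ge {δ d s : ℝ} (hk : 2 ≤ k) (hl : 2 ≤ lam) (hlk : 40 ≤ lam * k)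
    (hK : K = k + 1 / 2) (hx : x * K = 1) (hy : y = x ^ 2) (hw : w = 1 - y / 4)
    (hV : V = lam * K * w / 3) (hd : d = 3 * w / 8 + δ * x) (hd0 : 0 ≤ d)
    (hδ : (s = 1 ∧ 1 / 16 + 3 * x / 32 ≤ δ ∧ δ ≤ 1) ∨ (s = -1 ∧ -1 ≤ δ ∧ δ ≤ -1 / 19)) :
    ∃ B, 0 ≤ B ∧ B ≤ 1.1 * V ∧
      0.0025 * (∫ t in (0 : ℝ)..7 / 4, Real.exp (-(lam * cosGap k (t * x))) * t ^ 2) -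
        3 * Real.exp (-(lam * cosGap k (7 / 4 * x))) ≤
      s * (B * ∫ t in (0 : ℝ)..7 / 4, Real.exp (-(lam * cosGap k (t * x))) *
        (2 * K * Real.sin (t * x / 2) *
          Real.sin (d * t - lam * (powSum k 1 * (t * x) - sinSum k (t * x))))) := by
  have hk' : (2 : ℝ) ≤ k := by exact_mod_cast hk
  have hK0 : 5 / 2 ≤ K := by linarith
  have hxe : x = 1 / K := by rw [eq_div_iff (by linarith), hx]
  have hx0 : 0 < x := by rw [hxe]; positivity
  have hx1 : x ≤ 2 / 5 := by rw [hxe, div_le_iff₀ (by linarith)]; linarith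
  have hy1 : y ≤ 4 / 25 := by rw [hy]; nlinarith only [hx0, hx1]
  have hy0 : 0 ≤ y := hy ▸ sq_nonneg x
  have hlK : 41 ≤ lam * K := by rw [hK]; linarith
  have hw0 : 0 ≤ w := by linarith
  have hV41 : 41 * w / 3 ≤ V := by rw [hV]; linarith [mul_le_mul_of_nonneg_right hlK hw0]
  have hVx : 2 * w / 3 ≤ V * x := by
    have : V * x = lam * w / 3 := by rw [hV]; linear_combination lam * w / 3 * hx
    rw [this]; linarith [mul_le_mul_of_nonneg_right hl hw0]
  have hV0 : 0 < V := by linarith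
  obtain ⟨e2, e3, e4, e5, e6, e7⟩ := lam_mul_powSum_eq (lam := lam) hK hx hy hw hV
  have e8 := lam_mul_powSum_eight_le (by linarith : 0 ≤ lam) hK hx hx0 e2
  obtain ⟨a, ha⟩ : ∃ a, a = 3 * w / 8 := ⟨_, rfl⟩
  obtain ⟨e, he⟩ : ∃ e, e = δ * x := ⟨_, rfl⟩
  obtain ⟨m₄, hm₄⟩ : ∃ m, m = (3 * w - y) / 30 := ⟨_, rfl⟩
  obtain ⟨m₅, hm₅⟩ : ∃ m, m = w * (2 * w - y) / 96 := ⟨_, rfl⟩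
  obtain ⟨m₆, hm₆⟩ : ∃ m, m = (3 * w ^ 2 - 3 * w * y + y ^ 2) / 840 := ⟨_, rfl⟩
  obtain ⟨m₇, hm₇⟩ : ∃ m, m = w * (3 * w ^ 2 - 4 * w * y + 2 * y ^ 2) / 5760 := ⟨_, rfl⟩
  obtain ⟨c, hc⟩ : ∃ c, c = a * d - m₄ + y / 24 := ⟨_, rfl⟩
  obtain ⟨B, hB⟩ : ∃ B, B = V + 2 * c - d ^ 2 := ⟨_, rfl⟩
  obtain ⟨D, hD⟩ : ∃ D, D = s * (d - a - c * d / V) := ⟨_, rfl⟩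
  obtain ⟨c₃, hc₃⟩ : ∃ r, r = y / 24 * |d ^ 2 - 2 * c| / V := ⟨_, rfl⟩
  obtain ⟨c₅, hc₅⟩ : ∃ r, r = |m₄ * c - m₅ * d + m₆| + y ^ 2 * B / (1920 * V) := ⟨_, rfl⟩
  obtain ⟨r₄, hr₄⟩ : ∃ r, r = |a * c - m₄ * d + m₅| := ⟨_, rfl⟩
  obtain ⟨r₆, hr₆⟩ : ∃ r, r = d * m₆ + |c| * m₅ + m₇ := ⟨_, rfl⟩
  obtain ⟨r₇, hr₇⟩ : ∃ r, r = 1 / 5040 + |c| * m₆ + d * m₇ := ⟨_, rfl⟩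
  rw [← ha, ← he] at hd
  rw [← ha] at e3
  rw [← hm₄] at e4
  rw [← hm₅] at e5
  rw [← hm₆] at e6
  rw [← hm₇] at e7
  obtain ⟨hD0, hB0, hB1, hc1, hd1, hm₅0, hm₆0, hm₇0, hmain⟩ := margin_pos hx0 hx1 hy hw ha he hd hd0
    hm₄ hm₅ hm₆ hm₇ hc hV41 hVx hδ hB hD hc₃ hc₅ hr₄ hr₆ hr₇
  have hs : |s| = 1 := by rcases hδ with ⟨rfl, -⟩ | ⟨rfl, -⟩ <;> simp
  have hlx : 0 ≤ lam * x := by positivity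
  have htx : ∀ t : ℝ, 0 ≤ t → 0 ≤ t * x := fun t ht => by positivity
  have hid : ∀ t : ℝ, HasDerivAt (fun t : ℝ => t * x) x t := fun t => by
    simpa using (hasDerivAt_id t).mul_const x
  have hGd : ∀ t, HasDerivAt (fun t => lam * cosGap k (t * x))
      (lam * x * mulSinSum k (t * x)) t := fun t => by
    have h : HasDerivAt (fun t => cosGap k (t * x)) (mulSinSum k (t * x) * x) t :=
      HasDerivAt.comp (h₂ := cosGap k) t (hasDerivAt_cosGap k (t * x)) (hid t)
    exact (h.const_mul lam).congr_deriv (by ring)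
  have hHd : ∀ t, HasDerivAt (fun t => lam * (powSum k 1 * (t * x) - sinSum k (t * x)))
      (lam * x * mulCosGap k (t * x)) t := fun t => by
    have h : HasDerivAt (fun t => powSum k 1 * (t * x) - sinSum k (t * x))
        (mulCosGap k (t * x) * x) t :=
      HasDerivAt.comp (h₂ := fun t => powSum k 1 * t - sinSum k t) t
        (hasDerivAt_sub_sinSum k (t * x)) (hid t)
    exact (h.const_mul lam).congr_deriv (by ring)
  have hm₄1 : m₄ ≤ 0.1 := by rw [hm₄]; linarith
  have hg : ∀ t, 0 ≤ t → V * (t - m₄ * t ^ 3) ≤ lam * x * mulSinSum k (t * x) := fun t ht => by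
    refine le_trans (le_of_eq ?_) (mul_le_mul_of_nonneg_left (mulSinSum_ge k (htx t ht)) hlx)
    linear_combination t ^ 3 * e4 - t * e2
  have key := local_integral_ge (G := fun t => lam * cosGap k (t * x))
    (g := fun t => lam * x * mulSinSum k (t * x))
    (H := fun t => lam * (powSum k 1 * (t * x) - sinSum k (t * x)))
    (h := fun t => lam * x * mulCosGap k (t * x))
    (z := fun t => 2 * K * Real.sin (t * x / 2)) (T := 7 / 4) (V := V) (γ := 0.69) (a := a)
    (d := d) (y := y) (s := s) (c := c) (B := B) (m₄ := m₄) (m₅ := m₅) (m₆ := m₆) (m₇ := m₇)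
    (by norm_num) hV0 (by norm_num) hd0 (by rw [ha]; positivity) hy0 hs (hD ▸ hD0) hm₅0 hm₆0 hm₇0
    hc hB hB0
    hGd hHd
    (by fun_prop) (by fun_prop) (by fun_prop) (by simp [sinSum])
    (fun t ht ht' => by
      refine le_trans ?_ (hg t ht)
      have h1 : t ^ 2 ≤ (7 / 4) ^ 2 := by gcongr
      have h2 : m₄ * t ^ 2 ≤ 0.1 * (7 / 4) ^ 2 :=
        mul_le_mul hm₄1 h1 (sq_nonneg t) (by norm_num)
      have h3 : 0 ≤ V * t * (0.31 - m₄ * t ^ 2) := mul_nonneg (by positivity) (by linarith)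
      linarith)
    hg
    (fun t ht => by
      refine (mul_le_mul_of_nonneg_left (mulSinSum_le_quintic k (htx t ht)) hlx).trans_eq ?_
      linear_combination t * e2 - t ^ 3 * e4 + t ^ 5 * e6)
    (fun t ht => by
      refine le_trans ?_ (mul_le_mul_of_nonneg_left (mulSinSum_ge_septic k (htx t ht)) hlx)
      have := mul_le_mul_of_nonneg_left e8 (by positivity : 0 ≤ t ^ 7 / 5040)
      have e : lam * x * (powSum k 2 * (t * x) - powSum k 4 * (t * x) ^ 3 / 6 +
          powSum k 6 * (t * x) ^ 5 / 120 - powSum k 8 * (t * x) ^ 7 / 5040) =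
          V * (t - m₄ * t ^ 3 + m₆ * t ^ 5) - t ^ 7 / 5040 * (lam * powSum k 8 * x ^ 8) := by
        linear_combination t * e2 - t ^ 3 * e4 + t ^ 5 * e6
      rw [e]; linarith)
    (fun t ht => by
      refine le_trans (le_of_eq ?_) (mul_le_mul_of_nonneg_left (mulCosGap_ge k (htx t ht)) hlx)
      linear_combination t ^ 4 * e5 - t ^ 2 * e3)
    (fun t ht => by
      refine (mul_le_mul_of_nonneg_left (mulCosGap_le k) hlx).trans_eq ?_
      linear_combination t ^ 2 * e3)
    (fun t ht => by
      refine (mul_le_mul_of_nonneg_left (mulCosGap_le_sextic k (htx t ht)) hlx).trans_eq ?_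
      linear_combination t ^ 2 * e3 - t ^ 4 * e5 + t ^ 6 * e7)
    (fun t ht => mul_nonneg (by linarith) (sub_sinSum_nonneg k (htx t ht)))
    (fun t ht => by
      refine (mul_le_mul_of_nonneg_left (sub_sinSum_le k (htx t ht)) (by linarith)).trans_eq ?_
      linear_combination t ^ 3 / 3 * e3)
    (fun t ht => by
      have h := mul_le_mul_of_nonneg_left (Real.sin_ge_sub_cube (x := t * x / 2) (by positivity))
        (by linarith : 0 ≤ 2 * K)
      refine le_trans (le_of_eq ?_) h
      rw [hy]
      linear_combination (-t + t ^ 3 * x ^ 2 / 24) * hx)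
    (fun t ht => by
      have h := mul_le_mul_of_nonneg_left (sin_le_quintic (x := t * x / 2) (by positivity))
        (by linarith : 0 ≤ 2 * K)
      refine h.trans_eq ?_
      rw [hy]
      linear_combination (t - t ^ 3 * x ^ 2 / 24 + t ^ 5 * x ^ 4 / 1920) * hx)
    hD hc₃ hc₅ hr₄ hr₆ hr₇
  refine ⟨B, hB0, hB1, le_trans ?_ key⟩
  have hJ : 0 ≤ ∫ t in (0 : ℝ)..7 / 4, Real.exp (-(lam * cosGap k (t * x))) * t ^ 2 :=
    integral_nonneg (by norm_num) fun t _ => by positivity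
  have h1 := mul_le_mul_of_nonneg_right hmain hJ
  have h2 : Real.exp (-(lam * cosGap k (7 / 4 * x))) * (1 + |c| * (7 / 4) ^ 2 + d * (7 / 4)) ≤
      Real.exp (-(lam * cosGap k (7 / 4 * x))) * 3 :=
    mul_le_mul_of_nonneg_left (by linarith) (Real.exp_pos _).le
  rw [mul_assoc] at h1
  linarith

end Rescaling

section Tails

open intervalIntegral

variable {k : ℕ} {lam K x y w V : ℝ}

theorem two_mul_sin_mul_cosGap (k : ℕ) (θ : ℝ) : 2 * Real.sin (θ / 2) * cosGap k θ =
    2 * Real.sin (θ / 2) * (k + 1 / 2) - Real.sin ((k + 1 / 2) * θ) := by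
  induction k with
  | zero => simp [cosGap]; ring_nf
  | succ k ih =>
    have h : cosGap (k + 1) θ = cosGap k θ + (1 - Real.cos ((k + 1) * θ)) := by
      rw [cosGap, Finset.sum_range_succ]; rfl
    have e₁ : ((k + 1 : ℕ) + 1 / 2 : ℝ) * θ = (k + 1) * θ + θ / 2 := by push_cast; ring
    have e₂ : ((k : ℝ) + 1 / 2) * θ = (k + 1) * θ - θ / 2 := by ring
    rw [e₂, Real.sin_sub] at ih
    rw [h, mul_add, ih, e₁, Real.sin_add]
    push_cast
    ring

theorem cosGap_ge_of_pi_le (hK : K = k + 1 / 2) {θ : ℝ} (h1 : Real.pi ≤ K * θ)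
    (h2 : θ ≤ Real.pi) (hθ : 0 < θ) : 3 / 4 * K ≤ cosGap k θ := by
  have hK0 : 0 < K := by rw [hK]; positivity
  have hsin : 0 < Real.sin (θ / 2) := Real.sin_pos_of_pos_of_lt_pi (by linarith)
    (by linarith [Real.pi_pos])
  have h := two_mul_sin_mul_cosGap k θ
  rw [← hK] at h
  have hle : Real.sin (K * θ) ≤ 2 * Real.sin (θ / 2) * (K / 4) := by
    rcases le_total (K * θ) (2 * Real.pi) with h3 | h3
    · have h4 : 0 ≤ Real.sin (K * θ - Real.pi) :=
        Real.sin_nonneg_of_nonneg_of_le_pi (by linarith) (by linarith)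
      rw [Real.sin_sub_pi] at h4
      have : 0 ≤ 2 * Real.sin (θ / 2) * (K / 4) := by positivity
      linarith
    · have h4 : 2 / Real.pi * (θ / 2) ≤ Real.sin (θ / 2) :=
        Real.mul_le_sin (by linarith) (by linarith)
      refine (Real.sin_le_one _).trans ?_
      have h5 : 2 / K ≤ 2 / Real.pi * (θ / 2) := by
        rw [div_le_iff₀ hK0]
        have : 2 / Real.pi * (θ / 2) * K = K * θ / Real.pi := by ring
        rw [this, le_div_iff₀ Real.pi_pos]
        exact h3
      have h6 : 2 / K * K ≤ Real.sin (θ / 2) * K :=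
        mul_le_mul_of_nonneg_right (h5.trans h4) hK0.le
      rw [div_mul_cancel₀ _ hK0.ne'] at h6
      linarith
  have h5 : 2 * Real.sin (θ / 2) * (3 / 4 * K) ≤ 2 * Real.sin (θ / 2) * cosGap k θ := by linarith
  exact le_of_mul_le_mul_left h5 (by linarith)

theorem lam_mul_cosGap_ge (hl : 0 ≤ lam) (hK : K = k + 1 / 2) (hx : x * K = 1) (hx0 : 0 ≤ x)
    (hx1 : x ≤ 2 / 5) {t : ℝ} (ht : 7 / 4 ≤ t) (ht' : t ≤ Real.pi) :
    0.4 * (lam * K) ≤ lam * cosGap k (t * x) := by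
  obtain ⟨y, hy⟩ : ∃ y, y = x ^ 2 := ⟨_, rfl⟩
  obtain ⟨w, hw⟩ : ∃ w, w = 1 - y / 4 := ⟨_, rfl⟩
  obtain ⟨V, hV⟩ : ∃ V, V = lam * K * w / 3 := ⟨_, rfl⟩
  obtain ⟨e2, -, e4, -⟩ := lam_mul_powSum_eq (lam := lam) hK hx hy hw hV
  have hy1 : y ≤ 4 / 25 := by rw [hy]; nlinarith only [hx0, hx1]
  have hy0 : 0 ≤ y := hy ▸ sq_nonneg x
  have hK0 : 0 ≤ K := by rw [hK]; positivity
  have ht0 : 0 ≤ t * x := mul_nonneg (by linarith) hx0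
  refine le_trans ?_ (mul_le_mul_of_nonneg_left (cosGap_ge k ht0) hl)
  have e : lam * (powSum k 2 * (t * x) ^ 2 / 2 - powSum k 4 * (t * x) ^ 4 / 24) =
      lam * K * (w / 3 * (t ^ 2 / 2 - (3 * w - y) / 30 * t ^ 4 / 4)) := by
    rw [hV] at e2 e4
    linear_combination t ^ 2 / 2 * e2 - t ^ 4 / 4 * e4
  rw [e, mul_comm]
  refine mul_le_mul_of_nonneg_left ?_ (mul_nonneg hl hK0)
  have hu : (7 / 4) ^ 2 ≤ t ^ 2 := by gcongr
  have hu' : t ^ 2 ≤ 10 := by nlinarith only [ht, ht', Real.pi_lt_d2, Real.pi_pos]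
  have h1 : 1.25 ≤ t ^ 2 / 2 - (3 * w - y) / 30 * t ^ 4 / 4 := by
    have h2 : (3 * w - y) / 30 * t ^ 4 ≤ 0.1 * t ^ 4 :=
      mul_le_mul_of_nonneg_right (by linarith) (by positivity)
    nlinarith only [h2, hu, hu']
  calc (0.4 : ℝ) ≤ 0.96 / 3 * 1.25 := by norm_num
    _ ≤ _ := mul_le_mul (by linarith) h1 (by norm_num) (by linarith)

theorem integral_sq_ge (hl : 0 ≤ lam) (hV : lam * powSum k 2 * x ^ 2 = V) (hV0 : 13.12 ≤ V) :
    17 / V ^ 3 ≤ ∫ t in (0 : ℝ)..7 / 4, Real.exp (-(lam * cosGap k (t * x))) * t ^ 2 := by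
  have hb : 5 / V ≤ 7 / 4 := by rw [div_le_iff₀ (by linarith)]; linarith
  have hV1 : 0 < V := by linarith
  have hii : ∀ a b : ℝ, IntervalIntegrable
      (fun t => Real.exp (-(lam * cosGap k (t * x))) * t ^ 2) MeasureTheory.volume a b :=
    fun a b => (by fun_prop : Continuous _).intervalIntegrable _ _
  have h1 : ∫ t in (0 : ℝ)..5 / V, (t ^ 2 - V / 2 * t ^ 4) ≤
      ∫ t in (0 : ℝ)..5 / V, Real.exp (-(lam * cosGap k (t * x))) * t ^ 2 := by
    refine integral_mono_on (by positivity)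
      ((by fun_prop : Continuous _).intervalIntegrable _ _) (hii _ _) fun t _ => ?_
    have h2 := Real.add_one_le_exp (-(lam * cosGap k (t * x)))
    have h3 := mul_le_mul_of_nonneg_left (cosGap_le k (θ := t * x)) hl
    have h4 : lam * (powSum k 2 * (t * x) ^ 2 / 2) = V / 2 * t ^ 2 := by rw [← hV]; ring
    have h5 : (1 - V / 2 * t ^ 2) * t ^ 2 ≤ Real.exp (-(lam * cosGap k (t * x))) * t ^ 2 :=
      mul_le_mul_of_nonneg_right (by linarith) (sq_nonneg t)
    linarith
  have h2 : ∫ t in (0 : ℝ)..5 / V, (t ^ 2 - V / 2 * t ^ 4) =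
      125 / V ^ 3 * (1 / 3 - 5 / (2 * V)) := by
    rw [integral_sub ((by fun_prop : Continuous _).intervalIntegrable _ _)
      ((by fun_prop : Continuous _).intervalIntegrable _ _), integral_const_mul, integral_pow,
      integral_pow]
    have := hV1.ne'
    norm_num
    field_simp
    ring
  have h3 : 0 ≤ ∫ t in 5 / V..7 / 4, Real.exp (-(lam * cosGap k (t * x))) * t ^ 2 :=
    integral_nonneg hb fun t _ => by positivity
  rw [← integral_add_adjacent_intervals (hii 0 (5 / V)) (hii _ _)]
  have h4 : 17 / V ^ 3 ≤ 125 / V ^ 3 * (1 / 3 - 5 / (2 * V)) := by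
    have h5 : 5 / (2 * V) ≤ 0.197 := by rw [div_le_iff₀ (by positivity)]; linarith
    have h6 : 125 / V ^ 3 * 0.136 ≤ 125 / V ^ 3 * (1 / 3 - 5 / (2 * V)) :=
      mul_le_mul_of_nonneg_left (by linarith) (by positivity)
    refine le_trans (le_of_eq ?_) h6
    ring
  linarith

theorem mul_le_exp_tenth {N : ℝ} (hN : 41 ≤ N) : 1.2 * N ≤ Real.exp (N / 10) := by
  have h1 : Real.exp (N / 10) = Real.exp 1 ^ 4 * Real.exp 0.1 * Real.exp ((N - 41) / 10) := by
    rw [← Real.exp_nat_mul, ← Real.exp_add, ← Real.exp_add]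
    congr 1
    norm_num
    ring
  have h2 : (2.7182818283 : ℝ) ^ 4 ≤ Real.exp 1 ^ 4 :=
    pow_le_pow_left₀ (by norm_num) Real.exp_one_gt_d9.le 4
  have h3 : (1.1 : ℝ) ≤ Real.exp 0.1 := by linarith [Real.add_one_le_exp (0.1 : ℝ)]
  have h4 : (N - 41) / 10 + 1 ≤ Real.exp ((N - 41) / 10) := Real.add_one_le_exp _
  have h5 : 60 * ((N - 41) / 10 + 1) ≤ Real.exp (N / 10) := by
    rw [h1]
    refine mul_le_mul ?_ h4 (by linarith) (by positivity)
    calc (60 : ℝ) ≤ 2.7182818283 ^ 4 * 1.1 := by norm_num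
      _ ≤ _ := mul_le_mul h2 h3 (by norm_num) (by positivity)
  linarith

theorem tail_numeric {N K V B : ℝ} (hN : 41 ≤ N) (hKN : K ≤ N / 2) (hK : 0 ≤ K)
    (hV0 : 0 < V) (hVN : V ≤ N / 3) (hB : B ≤ 1.1 * V) :
    3 * Real.exp (-(0.4 * N)) + B * (5 * Real.exp (-(0.4 * N)) +
      7 * K ^ 2 * Real.exp (-(3 / 4 * N))) < 0.0025 * (17 / V ^ 3) := by
  have hb := mul_le_exp_tenth hN
  have hN0 : 0 < N := by linarith
  obtain ⟨q, hq⟩ : ∃ q, q = Real.exp (-(N / 10)) := ⟨_, rfl⟩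
  have hq0 : 0 < q := hq ▸ Real.exp_pos _
  have hqN : q * N ≤ 1 / 1.2 := by
    rw [hq, Real.exp_neg, inv_mul_eq_div, div_le_iff₀ (Real.exp_pos _)]
    linarith
  have e1 : Real.exp (-(0.4 * N)) = q ^ 4 := by
    rw [hq, ← Real.exp_nat_mul]; congr 1; norm_num; ring
  have e2 : Real.exp (-(3 / 4 * N)) ≤ q ^ 7 := by
    rw [hq, ← Real.exp_nat_mul]; apply Real.exp_le_exp.2; push_cast; linarith
  rw [e1]
  have hqN0 : 0 ≤ q * N := by positivity
  have h3 : (q * N) ^ 3 ≤ (1 / 1.2) ^ 3 := pow_le_pow_left₀ hqN0 hqN 3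
  have h4 : (q * N) ^ 4 ≤ (1 / 1.2) ^ 4 := pow_le_pow_left₀ hqN0 hqN 4
  have hq3 : 7 * K ^ 2 * q ^ 7 ≤ q ^ 4 := by
    have h5 : 7 * K ^ 2 * q ^ 3 ≤ 1 := by
      have h6 : K ^ 2 ≤ (N / 2) ^ 2 := pow_le_pow_left₀ hK hKN 2
      have h7 : 7 * K ^ 2 * q ^ 3 * N ≤ 7 / 4 * (q * N) ^ 3 := by
        calc 7 * K ^ 2 * q ^ 3 * N ≤ 7 * (N / 2) ^ 2 * q ^ 3 * N := by gcongr
          _ = _ := by ring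
      have h8 : 7 * K ^ 2 * q ^ 3 * N ≤ 1 * N := by norm_num at h3; linarith
      exact le_of_mul_le_mul_right h8 hN0
    calc 7 * K ^ 2 * q ^ 7 = 7 * K ^ 2 * q ^ 3 * q ^ 4 := by ring
      _ ≤ 1 * q ^ 4 := mul_le_mul_of_nonneg_right h5 (by positivity)
      _ = q ^ 4 := one_mul _
  have htail : 5 * q ^ 4 + 7 * K ^ 2 * Real.exp (-(3 / 4 * N)) ≤ 6 * q ^ 4 := by
    have := mul_le_mul_of_nonneg_left e2 (by positivity : 0 ≤ 7 * K ^ 2)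
    linarith
  have hBN : B ≤ 1.1 / 3 * N := by linarith
  have h5 : B * (5 * q ^ 4 + 7 * K ^ 2 * Real.exp (-(3 / 4 * N))) ≤ 1.1 / 3 * N * (6 * q ^ 4) :=
    mul_le_mul hBN htail (by positivity) (by positivity)
  have h6 : 0.0025 * (17 / (N / 3) ^ 3) ≤ 0.0025 * (17 / V ^ 3) := by gcongr
  refine lt_of_lt_of_le ?_ h6
  have h7 : 3 * q ^ 4 + 1.1 / 3 * N * (6 * q ^ 4) ≤ 2.28 * N * q ^ 4 := by
    have : 0 ≤ (0.08 * N - 3) * q ^ 4 := mul_nonneg (by linarith) (by positivity)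
    linarith
  refine lt_of_le_of_lt (by linarith : _ ≤ 2.28 * N * q ^ 4) ?_
  have h8 : 0.0025 * (17 / (N / 3) ^ 3) = 1.1475 / N ^ 3 := by field_simp; norm_num
  rw [h8, lt_div_iff₀ (by positivity)]
  have h9 : 2.28 * N * q ^ 4 * N ^ 3 = 2.28 * (q * N) ^ 4 := by ring
  rw [h9]
  norm_num at h4 ⊢
  linarith

theorem abs_two_mul_sin_mul_le (hx : x * K = 1) (hK : 0 ≤ K) (hx0 : 0 ≤ x) {t : ℝ} (ht : 0 ≤ t)
    (u : ℝ) : |2 * K * Real.sin (t * x / 2) * Real.sin u| ≤ t ∧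
      |2 * K * Real.sin (t * x / 2) * Real.sin u| ≤ 2 * K := by
  have h1 : |2 * K * Real.sin (t * x / 2) * Real.sin u| ≤ 2 * K * |Real.sin (t * x / 2)| := by
    rw [abs_mul, abs_mul, abs_of_nonneg (by positivity : 0 ≤ 2 * K)]
    exact mul_le_of_le_one_right (by positivity) (Real.abs_sin_le_one u)
  have h2 : |Real.sin (t * x / 2)| ≤ t * x / 2 := by
    have := Real.abs_sin_le_abs (x := t * x / 2)
    rwa [abs_of_nonneg (by positivity : 0 ≤ t * x / 2)] at this
  refine ⟨h1.trans ?_, h1.trans (mul_le_of_le_one_right (by positivity) (Real.abs_sin_le_one _))⟩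
  calc 2 * K * |Real.sin (t * x / 2)| ≤ 2 * K * (t * x / 2) := by gcongr
    _ = t := by linear_combination t * hx

/-- The sign of the Fourier integral, in rescaled variables. -/
theorem rescaled_integral_pos {δ d s : ℝ} (hk : 2 ≤ k) (hl : 2 ≤ lam) (hlk : 40 ≤ lam * k)
    (hK : K = k + 1 / 2) (hx : x * K = 1) (hd : d = 3 * (1 - x ^ 2 / 4) / 8 + δ * x) (hd0 : 0 ≤ d)
    (hδ : (s = 1 ∧ 1 / 16 + 3 * x / 32 ≤ δ ∧ δ ≤ 1) ∨ (s = -1 ∧ -1 ≤ δ ∧ δ ≤ -1 / 19)) :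
    0 < s * ∫ t in (0 : ℝ)..Real.pi * K, Real.exp (-(lam * cosGap k (t * x))) *
        (2 * K * Real.sin (t * x / 2) *
          Real.sin (d * t - lam * (powSum k 1 * (t * x) - sinSum k (t * x)))) := by
  obtain ⟨w, hw⟩ : ∃ w, w = 1 - x ^ 2 / 4 := ⟨_, rfl⟩
  obtain ⟨V, hV⟩ : ∃ V, V = lam * K * w / 3 := ⟨_, rfl⟩
  rw [← hw] at hd
  have hk' : (2 : ℝ) ≤ k := by exact_mod_cast hk
  have hK0 : 5 / 2 ≤ K := by linarith
  have hKp : 0 ≤ K := by linarith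
  have hl0 : 0 ≤ lam := by linarith
  have hxe : x = 1 / K := by rw [eq_div_iff (by linarith), hx]
  have hx0 : 0 < x := by rw [hxe]; positivity
  have hx1 : x ≤ 2 / 5 := by rw [hxe, div_le_iff₀ (by linarith)]; linarith
  have hw1 : 0.96 ≤ w := by rw [hw]; nlinarith only [hx0, hx1]
  have hw2 : w ≤ 1 := by rw [hw]; linarith [sq_nonneg x]
  have hlK : 41 ≤ lam * K := by rw [hK]; linarith
  have hV0 : 13.12 ≤ V := by rw [hV]; nlinarith only [hlK, hw1]
  have hV1 : V ≤ lam * K / 3 := by rw [hV]; nlinarith only [hlK, hw2]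
  obtain ⟨B, hB0, hB1, hloc⟩ := rescaled_local_ge hk hl hlk hK hx rfl hw hV hd hd0 hδ
  have hs : |s| = 1 := by rcases hδ with ⟨rfl, -⟩ | ⟨rfl, -⟩ <;> simp
  have hsq := integral_sq_ge hl0 (lam_mul_powSum_eq (lam := lam) hK hx rfl hw hV).1 hV0
  have hpi := Real.pi_pos
  have hpi1 := Real.pi_gt_d2
  have hpi2 := Real.pi_lt_d2
  set W : ℝ → ℝ := fun t => Real.exp (-(lam * cosGap k (t * x))) with hW
  set F : ℝ → ℝ := fun t => W t * (2 * K * Real.sin (t * x / 2) *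
    Real.sin (d * t - lam * (powSum k 1 * (t * x) - sinSum k (t * x)))) with hF
  have hFc : Continuous F := by rw [hF, hW]; fun_prop
  have hWle : W (7 / 4) ≤ Real.exp (-(0.4 * (lam * K))) := Real.exp_le_exp.2 (neg_le_neg
    (lam_mul_cosGap_ge hl0 hK hx hx0.le hx1 le_rfl (by linarith)))
  have hnear : |∫ t in (7 / 4 : ℝ)..Real.pi, F t| ≤ 5 * Real.exp (-(0.4 * (lam * K))) := by
    have h := norm_integral_le_of_norm_le_const (a := 7 / 4) (b := Real.pi) (f := F)
      (C := Real.exp (-(0.4 * (lam * K))) * Real.pi) fun t ht => by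
        rw [Set.uIoc_of_le (by linarith)] at ht
        rw [hF, Real.norm_eq_abs, abs_mul, abs_of_pos (Real.exp_pos _)]
        refine mul_le_mul (Real.exp_le_exp.2 (neg_le_neg
          (lam_mul_cosGap_ge hl0 hK hx hx0.le hx1 ht.1.le ht.2))) ?_ (abs_nonneg _)
          (Real.exp_pos _).le
        exact (abs_two_mul_sin_mul_le hx hKp hx0.le (by linarith [ht.1]) _).1.trans ht.2
    rw [Real.norm_eq_abs, abs_of_nonneg (by linarith : 0 ≤ Real.pi - 7 / 4)] at h
    refine h.trans ?_
    have h2 : Real.pi * (Real.pi - 7 / 4) ≤ 5 := by nlinarith only [hpi1, hpi2]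
    rw [mul_assoc, mul_comm 5]
    exact mul_le_mul_of_nonneg_left h2 (Real.exp_pos _).le
  have hfar : |∫ t in Real.pi..Real.pi * K, F t| ≤
      7 * K ^ 2 * Real.exp (-(3 / 4 * (lam * K))) := by
    have hle : Real.pi ≤ Real.pi * K := le_mul_of_one_le_right hpi.le (by linarith)
    have h := norm_integral_le_of_norm_le_const (a := Real.pi) (b := Real.pi * K) (f := F)
      (C := Real.exp (-(3 / 4 * (lam * K))) * (2 * K)) fun t ht => by
        rw [Set.uIoc_of_le hle] at ht
        rw [hF, Real.norm_eq_abs, abs_mul, abs_of_pos (Real.exp_pos _)]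
        have ht0 : 0 < t := hpi.trans ht.1
        refine mul_le_mul (Real.exp_le_exp.2 (neg_le_neg ?_))
          (abs_two_mul_sin_mul_le hx hKp hx0.le ht0.le _).2 (abs_nonneg _) (Real.exp_pos _).le
        have h2 := cosGap_ge_of_pi_le hK (θ := t * x)
          (by linarith [ht.1, (by linear_combination t * hx : K * (t * x) = t)])
          (by
            have := mul_le_mul_of_nonneg_right ht.2 hx0.le
            rwa [mul_assoc, mul_comm K, hx, mul_one] at this) (by positivity)
        linarith [mul_le_mul_of_nonneg_left h2 hl0]
    rw [Real.norm_eq_abs, abs_of_nonneg (by linarith : 0 ≤ Real.pi * K - Real.pi)] at h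
    refine h.trans ?_
    have h2 : 2 * K * (Real.pi * K - Real.pi) ≤ 7 * K ^ 2 := by
      nlinarith only [hpi, hpi2, sq_nonneg K, mul_nonneg hpi.le hKp]
    rw [mul_assoc, mul_comm (7 * K ^ 2)]
    exact mul_le_mul_of_nonneg_left h2 (Real.exp_pos _).le
  have hsplit : ∫ t in (0 : ℝ)..Real.pi * K, F t = (∫ t in (0 : ℝ)..7 / 4, F t) +
      ((∫ t in (7 / 4 : ℝ)..Real.pi, F t) + ∫ t in Real.pi..Real.pi * K, F t) := by
    rw [integral_add_adjacent_intervals (hFc.intervalIntegrable _ _)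
      (hFc.intervalIntegrable _ _), integral_add_adjacent_intervals (hFc.intervalIntegrable _ _)
      (hFc.intervalIntegrable _ _)]
  have htail : -(5 * Real.exp (-(0.4 * (lam * K))) +
      7 * K ^ 2 * Real.exp (-(3 / 4 * (lam * K)))) ≤
      s * ((∫ t in (7 / 4 : ℝ)..Real.pi, F t) + ∫ t in Real.pi..Real.pi * K, F t) := by
    refine (abs_le.1 ?_).1
    rw [abs_mul, hs, one_mul]
    exact (abs_add_le _ _).trans (add_le_add hnear hfar)
  have hnum := tail_numeric hlK (by linarith [mul_le_mul_of_nonneg_right hl hKp]) hKp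
    (by linarith : 0 < V) hV1 hB1
  have h1 := mul_le_mul_of_nonneg_left htail hB0
  have hpos : 0 < B * (s * ∫ t in (0 : ℝ)..Real.pi * K, F t) := by
    rw [hsplit]
    linarith
  by_contra! hneg
  linarith [mul_nonpos_of_nonneg_of_nonpos hB0 hneg]

/-- The sign of `orderKSum k λ n - orderKSum k λ (n + 1)` for `n` near the mode. -/
theorem mul_orderKSum_sub_neg {δ s : ℝ} {n : ℕ} (hk : 2 ≤ k) (hl : 2 ≤ lam) (hlk : 40 ≤ lam * k)
    (hK : K = k + 1 / 2) (hx : x * K = 1) (hd0 : 0 ≤ 3 * (1 - x ^ 2 / 4) / 8 + δ * x)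
    (hδ : (s = 1 ∧ 1 / 16 + 3 * x / 32 ≤ δ ∧ δ ≤ 1) ∨ (s = -1 ∧ -1 ≤ δ ∧ δ ≤ -1 / 19))
    (hn : (n : ℝ) + 1 / 2 = lam * powSum k 1 - (3 * (K - x / 4) / 8 + δ)) :
    s * (orderKSum k lam n - orderKSum k lam (n + 1)) < 0 := by
  have h := rescaled_integral_pos hk hl hlk hK hx rfl hd0 hδ
  have hK0 : 0 < K := by rw [hK]; positivity
  have hx0 : x ≠ 0 := fun h => by simp [h] at hx
  have hxe : x⁻¹ = K := by rw [inv_eq_iff_eq_inv]; exact eq_inv_of_mul_eq_one_left hx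
  obtain ⟨f, hf⟩ : ∃ f : ℝ → ℝ, f = fun θ => Real.exp (-lam * cosGap k θ) *
    (Real.sin (θ / 2) * Real.sin ((n + 1 / 2) * θ - lam * sinSum k θ)) := ⟨_, rfl⟩
  have hsub := orderKSum_sub_succ k lam n
  have hF : ∀ t, Real.exp (-(lam * cosGap k (t * x))) * (2 * K * Real.sin (t * x / 2) *
      Real.sin ((3 * (1 - x ^ 2 / 4) / 8 + δ * x) * t -
        lam * (powSum k 1 * (t * x) - sinSum k (t * x)))) = -(2 * K) * f (t * x) := fun t => by
    have e : (3 * (1 - x ^ 2 / 4) / 8 + δ * x) * t -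
        lam * (powSum k 1 * (t * x) - sinSum k (t * x)) =
        -((n + 1 / 2) * (t * x) - lam * sinSum k (t * x)) := by
      rw [hn]; linear_combination (-3 / 8) * t * hx
    rw [e, Real.sin_neg, hf]
    simp only [neg_mul]
    ring
  simp only [hF] at h
  rw [integral_const_mul, integral_comp_mul_right _ hx0, hxe, zero_mul, mul_assoc, mul_comm K, hx,
    mul_one, smul_eq_mul] at h
  have e : s * (-(2 * K) * (K * ∫ θ in (0 : ℝ)..Real.pi, f θ)) =
      -(K ^ 2 * Real.pi * Real.exp (-(k * lam))) *
        (s * (orderKSum k lam n - orderKSum k lam (n + 1))) := by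
    rw [hf]
    linear_combination (s * K ^ 2) * hsub
  rw [e, neg_mul, neg_pos] at h
  by_contra! hneg
  linarith [mul_nonneg (by positivity : 0 ≤ K ^ 2 * Real.pi * Real.exp (-(k * lam))) hneg]

end Tails

/-- Application of `f` to `n` that makes the kernel evaluate `n` first. -/
def force {α : Type} (n : ℕ) (f : ℕ → α) : α := Nat.rec (f 0) (fun m _ => f (Nat.succ m)) n

theorem force_eq {α : Type} (n : ℕ) (f : ℕ → α) : force n f = f n := by cases n <;> rfl

/-- Fixed-point evaluation of the recursion for `orderKSum k (N / κ)`. The state consists of the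
index `n`, the last `k + 1` values packed in base `B` into `Q`, and the two window sums
`S₁ = Σ a (n - j)`, `S₂ = Σ j a (n - j)`. -/
def runRec (k N κ B Bk Bk' : ℕ) (fuel : ℕ) : ℕ → ℕ → ℕ → ℕ → (ℕ → ℕ → Bool) → Bool :=
  Nat.rec (fun n Q _ _ c => c n Q)
    (fun _ ih n Q S₁ S₂ c =>
      (fun y x => force (Nat.add (Nat.mul (Nat.mod Q Bk) B) y) fun Q' =>
        force (Nat.sub (Nat.add S₁ y) x) fun S₁' =>
        force (Nat.sub (Nat.add y (Nat.add S₁ S₂)) (Nat.mul (Nat.succ k) x)) fun S₂' =>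
        ih (Nat.succ n) Q' S₁' S₂' c)
      (Nat.div (Nat.mul N S₂) (Nat.mul κ n)) (Nat.mod (Nat.div Q Bk') B)) fuel

/-- The test on the final state: the second last of the packed values exceeds its neighbours. -/
def modeTest (B one n Q : ℕ) : Bool :=
  force (Nat.mod Q B) fun c => force (Nat.mod (Nat.div Q B) B) fun b =>
  force (Nat.mod (Nat.div Q (Nat.mul B B)) B) fun a =>
  and (Nat.ble one c) (and (Nat.ble (Nat.succ (Nat.mul a one)) (Nat.mul b (Nat.sub one n)))
    (Nat.ble (Nat.succ (Nat.mul c one)) (Nat.mul b (Nat.sub one n))))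

/-- The test that the fixed-point values have a strict maximum at `N - s`. -/
def modeCheck (k N : ℕ) : Bool :=
  force (Nat.add 1 (Nat.sub N (Nat.div (Nat.add (Nat.mul 3 k) 5) 8))) fun fuel =>
  force (Nat.pow 2 100) fun B => force (Nat.pow 2 40) fun one =>
  force (Nat.pow B k) fun Bk => force (Nat.pow B (Nat.sub k 1)) fun Bk' =>
  force (Nat.div (Nat.mul k (Nat.add k 1)) 2) fun κ =>
  runRec k N κ B Bk Bk' fuel 1 one one one (modeTest B one)

theorem modeCheck_eq (k N : ℕ) : modeCheck k N =
    runRec k N (k * (k + 1) / 2) (2 ^ 100) ((2 ^ 100) ^ k) ((2 ^ 100) ^ (k - 1))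
      (1 + (N - (3 * k + 5) / 8)) 1 (2 ^ 40) (2 ^ 40) (2 ^ 40) (modeTest (2 ^ 100) (2 ^ 40)) := by
  unfold modeCheck
  simp only [force_eq]
  rfl

theorem modeTest_iff (B one n Q : ℕ) : modeTest B one n Q = true ↔
    one ≤ Q % B ∧ Q / (B * B) % B * one < Q / B % B * (one - n) ∧
      Q % B * one < Q / B % B * (one - n) := by
  unfold modeTest
  simp only [force_eq, Bool.and_eq_true, Nat.ble_eq]
  rfl

/-- `modeCheck k` on `fuel` consecutive integers. -/
def modeCheckRange (k fuel : ℕ) : ℕ → Bool :=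
  Nat.rec (fun _ => true)
    (fun _ ih N => Bool.rec false (force (Nat.succ N) ih) (modeCheck k N)) fuel

theorem modeCheckRange_all {k : ℕ} (hk : 2 ≤ k) (hk' : k < 20) :
    modeCheckRange k ((20 - k) * (k + 1)) (k * (k + 1)) = true := by
  interval_cases k <;> decide +kernel

section FixedPoint

variable (k N κ : ℕ)

/-- The fixed-point values, newest first. -/
def fpHist : ℕ → List ℕ
  | 0 => [2 ^ 40]
  | n + 1 => N * (∑ j ∈ Finset.range k, (j + 1) * (fpHist n).getD j 0) / (κ * (n + 1)) :: fpHist n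

/-- The fixed-point approximation of `2 ^ 40 * orderKSum k (N / κ) n`. -/
def fpVal (n : ℕ) : ℕ := (fpHist k N κ n).getD 0 0

/-- The `j`-th last of the first `n + 1` fixed-point values. -/
def fpPrev (n j : ℕ) : ℕ := (fpHist k N κ n).getD j 0

theorem fpVal_zero : fpVal k N κ 0 = 2 ^ 40 := by simp [fpVal, fpHist]

theorem fpPrev_zero (n : ℕ) : fpPrev k N κ n 0 = fpVal k N κ n := rfl

theorem fpPrev_succ (n j : ℕ) : fpPrev k N κ (n + 1) (j + 1) = fpPrev k N κ n j := by
  simp [fpPrev, fpHist]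

theorem fpPrev_eq (n j : ℕ) : fpPrev k N κ n j = if j ≤ n then fpVal k N κ (n - j) else 0 := by
  induction n generalizing j with
  | zero =>
    cases j with
    | zero => simp [fpPrev_zero]
    | succ j => simp [fpPrev, fpHist]
  | succ n ih =>
    cases j with
    | zero => simp [fpPrev_zero]
    | succ j => rw [fpPrev_succ, ih]; simp

theorem fpVal_succ (n : ℕ) : fpVal k N κ (n + 1) =
    N * (∑ j ∈ Finset.range k, (j + 1) * fpPrev k N κ n j) / (κ * (n + 1)) := by
  simp [fpVal, fpPrev, fpHist]

/-- All fixed-point values up to the index `n`, packed in base `B`. -/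
def fpPack (B : ℕ) : ℕ → ℕ
  | 0 => fpVal k N κ 0
  | n + 1 => fpPack B n * B + fpVal k N κ (n + 1)

theorem fpPack_div {B : ℕ} (hB : ∀ n, fpVal k N κ n < B) (n j : ℕ) :
    fpPack k N κ B n / B ^ j % B = fpPrev k N κ n j := by
  have hpos : 0 < B := (Nat.zero_le _).trans_lt (hB 0)
  induction n generalizing j with
  | zero =>
    cases j with
    | zero => simp [fpPack, fpPrev_zero, Nat.mod_eq_of_lt (hB 0)]
    | succ j =>
      have : fpVal k N κ 0 < B ^ (j + 1) :=
        (hB 0).trans_le (Nat.le_self_pow (Nat.succ_ne_zero j) B)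
      rw [fpPack, Nat.div_eq_of_lt this, fpPrev_eq]
      simp
  | succ n ih =>
    cases j with
    | zero =>
      simp [fpPack, fpPrev_zero, Nat.mod_eq_of_lt (hB (n + 1))]
    | succ j =>
      rw [fpPrev_succ, ← ih, pow_succ', ← Nat.div_div_eq_div_mul]
      congr 2
      rw [fpPack, mul_comm, Nat.mul_add_div hpos, Nat.div_eq_of_lt (hB _), add_zero]

/-- The sum of the last `k` values. -/
def fpSum₁ (n : ℕ) : ℕ := ∑ j ∈ Finset.range k, fpPrev k N κ n j

/-- The weighted sum of the last `k` values. -/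
def fpSum₂ (n : ℕ) : ℕ := ∑ j ∈ Finset.range k, (j + 1) * fpPrev k N κ n j

variable {k N κ}

theorem fpSum₁_succ (hk : 0 < k) (n : ℕ) :
    fpSum₁ k N κ (n + 1) + fpPrev k N κ n (k - 1) = fpSum₁ k N κ n + fpVal k N κ (n + 1) := by
  obtain ⟨k, rfl⟩ := Nat.exists_eq_add_of_le' hk
  unfold fpSum₁
  rw [Finset.sum_range_succ', Finset.sum_range_succ (fun j => fpPrev (k + 1) N κ n j)]
  simp only [fpPrev_succ, fpPrev_zero, Nat.add_sub_cancel]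
  ring

theorem fpSum₂_succ (hk : 0 < k) (n : ℕ) :
    fpSum₂ k N κ (n + 1) + (k + 1) * fpPrev k N κ n (k - 1) =
      fpVal k N κ (n + 1) + (fpSum₁ k N κ n + fpSum₂ k N κ n) := by
  obtain ⟨k, rfl⟩ := Nat.exists_eq_add_of_le' hk
  unfold fpSum₁ fpSum₂
  rw [Finset.sum_range_succ', Finset.sum_range_succ (fun j => fpPrev (k + 1) N κ n j),
    Finset.sum_range_succ (fun j => (j + 1) * fpPrev (k + 1) N κ n j)]
  simp only [fpPrev_succ, fpPrev_zero, Nat.add_sub_cancel, add_mul, Finset.sum_add_distrib, one_mul]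
  ring

theorem runRec_succ (B Bk Bk' fuel n Q S₁ S₂ : ℕ) (c : ℕ → ℕ → Bool) :
    runRec k N κ B Bk Bk' (fuel + 1) n Q S₁ S₂ c =
    runRec k N κ B Bk Bk' fuel (n + 1) (Q % Bk * B + N * S₂ / (κ * n))
      (S₁ + N * S₂ / (κ * n) - Q / Bk' % B)
      (N * S₂ / (κ * n) + (S₁ + S₂) - (k + 1) * (Q / Bk' % B)) c := by
  unfold runRec
  simp only [force_eq]
  rfl

theorem runRec_eq (hk : 0 < k) {B : ℕ} (hB : ∀ n, fpVal k N κ n < B) (fuel n : ℕ)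
    (c : ℕ → ℕ → Bool) :
    runRec k N κ B (B ^ k) (B ^ (k - 1)) fuel (n + 1) (fpPack k N κ B n % B ^ (k + 1))
      (fpSum₁ k N κ n) (fpSum₂ k N κ n) c =
    c (n + 1 + fuel) (fpPack k N κ B (n + fuel) % B ^ (k + 1)) := by
  induction fuel generalizing n with
  | zero => rfl
  | succ fuel ih =>
    have hpos : 0 < B := (Nat.zero_le _).trans_lt (hB 0)
    have hy : N * fpSum₂ k N κ n / (κ * (n + 1)) = fpVal k N κ (n + 1) := (fpVal_succ k N κ n).symm
    have hx : fpPack k N κ B n % B ^ (k + 1) / B ^ (k - 1) % B = fpPrev k N κ n (k - 1) := by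
      rw [show B ^ (k + 1) = B ^ (k - 1) * (B * B) by
        rw [← pow_two, ← pow_add]; congr 1; omega, Nat.mod_mul_right_div_self,
        Nat.mod_mul_left_mod, fpPack_div k N κ hB]
    have hQ : fpPack k N κ B n % B ^ (k + 1) % B ^ k * B + fpVal k N κ (n + 1) =
        fpPack k N κ B (n + 1) % B ^ (k + 1) := by
      have h1 : (fpPack k N κ B n * B + fpVal k N κ (n + 1)) / B = fpPack k N κ B n := by
        rw [mul_comm, Nat.mul_add_div hpos, Nat.div_eq_of_lt (hB _), add_zero]
      have h2 : (fpPack k N κ B n * B + fpVal k N κ (n + 1)) % B = fpVal k N κ (n + 1) := by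
        rw [Nat.mul_add_mod_self_right, Nat.mod_eq_of_lt (hB _)]
      rw [fpPack, pow_succ', Nat.mod_mul_left_mod, Nat.mod_mul, h1, h2]
      ring
    have hS₁ : fpSum₁ k N κ n + fpVal k N κ (n + 1) - fpPrev k N κ n (k - 1) =
        fpSum₁ k N κ (n + 1) := by
      rw [← fpSum₁_succ hk, Nat.add_sub_cancel]
    have hS₂ : fpVal k N κ (n + 1) + (fpSum₁ k N κ n + fpSum₂ k N κ n) -
        (k + 1) * fpPrev k N κ n (k - 1) = fpSum₂ k N κ (n + 1) := by
      rw [← fpSum₂_succ hk, Nat.add_sub_cancel]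
    have step : runRec k N κ B (B ^ k) (B ^ (k - 1)) (fuel + 1) (n + 1)
        (fpPack k N κ B n % B ^ (k + 1)) (fpSum₁ k N κ n) (fpSum₂ k N κ n) c =
        runRec k N κ B (B ^ k) (B ^ (k - 1)) fuel (n + 1 + 1)
        (fpPack k N κ B (n + 1) % B ^ (k + 1)) (fpSum₁ k N κ (n + 1)) (fpSum₂ k N κ (n + 1)) c := by
      rw [← hQ, ← hS₁, ← hS₂, ← hx, ← hy]
      exact runRec_succ ..
    rw [step, ih]
    congr 1
    · ring
    · congr 2; ring

end FixedPoint

theorem two_pow_mul_orderKSum_bounds {k N κ : ℕ} (hκ : 0 < κ) (hk : 0 < k) (hN : 2 * κ ≤ N)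
    {m : ℕ} (n : ℕ) :
    (fpVal k N κ n : ℝ) ≤ 2 ^ 40 * orderKSum k ((N : ℝ) / κ) n ∧
    (1 ≤ orderKSum k ((N : ℝ) / κ) m → n ≤ m →
      (2 ^ 40 - n) * orderKSum k ((N : ℝ) / κ) n ≤ fpVal k N κ n) := by
  have hκ' : (0 : ℝ) < κ := by exact_mod_cast hκ
  have hl2 : 2 ≤ (N : ℝ) / κ := by
    rw [le_div_iff₀ hκ']; exact_mod_cast hN
  set lam := (N : ℝ) / κ with hlam
  have hl : 0 ≤ lam := by linarith
  induction n using Nat.strong_induction_on with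
  | _ n ih =>
    rcases n with _ | n
    · norm_num [fpVal, fpHist, orderKSum_zero]
    have hn : (0 : ℝ) < (n : ℝ) + 1 := by positivity
    set h : ℕ → ℝ := fun j => if j + 1 ≤ n + 1 then orderKSum k lam (n + 1 - (j + 1)) else 0 with hh
    have hrec : ((n : ℝ) + 1) * orderKSum k lam (n + 1) =
        lam * ∑ j ∈ Finset.range k, ((j : ℝ) + 1) * h j := by
      have := orderKSum_rec k lam (n + 1)
      rwa [Nat.cast_succ] at this
    have hprev : ∀ j, (fpPrev k N κ n j : ℝ) ≤ 2 ^ 40 * h j := by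
      intro j
      rw [fpPrev_eq, hh]
      by_cases hj : j ≤ n
      · simp only [hj, if_true, Nat.add_le_add_iff_right, Nat.add_sub_add_right]
        exact (ih (n - j) (by omega)).1
      · simp [hj]
    have hsum : ((N * ∑ j ∈ Finset.range k, (j + 1) * fpPrev k N κ n j : ℕ) : ℝ) /
        (κ * (n + 1) : ℕ) =
          lam * (∑ j ∈ Finset.range k, ((j : ℝ) + 1) * fpPrev k N κ n j) / (n + 1) := by
      rw [hlam]; push_cast; field_simp
    have horder : orderKSum k lam (n + 1) =
        lam * (∑ j ∈ Finset.range k, ((j : ℝ) + 1) * h j) / (n + 1) := by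
      rw [← hrec]; field_simp
    constructor
    · rw [fpVal_succ]
      refine Nat.cast_div_le.trans ?_
      rw [hsum, horder, ← mul_div_assoc, mul_left_comm, Finset.mul_sum (a := (2 : ℝ) ^ 40)]
      gcongr lam * ?_ / _
      refine Finset.sum_le_sum fun j _ => ?_
      rw [mul_left_comm]
      exact mul_le_mul_of_nonneg_left (hprev j) (by positivity)
    · intro hm hnm
      have hone : 1 ≤ orderKSum k lam (n + 1) := one_le_orderKSum hk hl2 hm hnm
      have hfl : lam * (∑ j ∈ Finset.range k, ((j : ℝ) + 1) * fpPrev k N κ n j) / (n + 1) <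
          fpVal k N κ (n + 1) + 1 := by
        rw [fpVal_succ, ← hsum]
        rw [div_lt_iff₀ (by positivity)]
        have := Nat.lt_mul_div_succ (N * ∑ j ∈ Finset.range k, (j + 1) * fpPrev k N κ n j)
          (show 0 < κ * (n + 1) by positivity)
        rw [mul_comm (κ * (n + 1))] at this
        exact_mod_cast this
      have hlow : ∀ j, (2 ^ 40 - n) * h j ≤ fpPrev k N κ n j := by
        intro j
        rw [fpPrev_eq, hh]
        by_cases hj : j ≤ n
        · simp only [hj, if_true, Nat.add_le_add_iff_right, Nat.add_sub_add_right]
          refine le_trans ?_ ((ih (n - j) (by omega)).2 hm (by omega))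
          refine mul_le_mul_of_nonneg_right ?_ (orderKSum_pos hk (by linarith) _).le
          have : ((n - j : ℕ) : ℝ) ≤ n := by exact_mod_cast Nat.sub_le _ _
          linarith
        · simp [hj]
      have h2 : (2 ^ 40 - n) * orderKSum k lam (n + 1) ≤
          lam * (∑ j ∈ Finset.range k, ((j : ℝ) + 1) * fpPrev k N κ n j) / (n + 1) := by
        rw [horder, ← mul_div_assoc, mul_left_comm, Finset.mul_sum (a := (2 : ℝ) ^ 40 - n)]
        gcongr lam * ?_ / _
        refine Finset.sum_le_sum fun j _ => ?_
        rw [mul_left_comm]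
        exact mul_le_mul_of_nonneg_left (hlow j) (by positivity)
      push_cast
      linarith

/-- The comparison at `N - s` for the small parameters, from the kernel computation. -/
theorem orderKSum_lt_of_small {k N : ℕ} (hk : 2 ≤ k) (hN : k * (k + 1) ≤ N)
    (hN' : N < 20 * (k + 1)) :
    orderKSum k ((N : ℝ) / (k * (k + 1) / 2 : ℕ)) (N - (3 * k + 5) / 8 - 1) <
      orderKSum k ((N : ℝ) / (k * (k + 1) / 2 : ℕ)) (N - (3 * k + 5) / 8) ∧
    orderKSum k ((N : ℝ) / (k * (k + 1) / 2 : ℕ)) (N - (3 * k + 5) / 8 + 1) <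
      orderKSum k ((N : ℝ) / (k * (k + 1) / 2 : ℕ)) (N - (3 * k + 5) / 8) := by
  have hk20 : k < 20 := by nlinarith
  have hk0 : 0 < k := by omega
  have hcheck : modeCheck k N = true := by
    have aux : ∀ fuel N₀, modeCheckRange k fuel N₀ = true → N₀ ≤ N → N < N₀ + fuel →
        modeCheck k N = true := by
      intro fuel
      induction fuel with
      | zero => intro N₀ _ h1 h2; omega
      | succ fuel ih =>
        intro N₀ h h1 h2
        change (Bool.rec false (force (Nat.succ N₀) (modeCheckRange k fuel))
          (modeCheck k N₀) : Bool) = true at h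
        rw [force_eq] at h
        cases hb : modeCheck k N₀ with
        | false => rw [hb] at h; exact absurd h (by simp)
        | true =>
          rw [hb] at h
          rcases h1.eq_or_lt with rfl | h1
          · exact hb
          · exact ih (N₀ + 1) h h1 (by omega)
    refine aux _ _ (modeCheckRange_all hk hk20) hN ?_
    obtain ⟨d, hd⟩ := Nat.exists_eq_add_of_le hk20.le
    have : k * (k + 1) + (20 - k) * (k + 1) = 20 * (k + 1) := by
      rw [← add_mul]; congr 1; omega
    omega
  set κ := k * (k + 1) / 2 with hκdef
  have h2κ : 2 * κ = k * (k + 1) := Nat.two_mul_div_two_of_even (Nat.even_mul_succ_self k)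
  have hκ : 0 < κ := by nlinarith
  set m := N - (3 * k + 5) / 8 with hm
  have hm1 : 1 ≤ m := by
    have : 2 * (k + 1) ≤ k * (k + 1) := Nat.mul_le_mul_right _ hk
    omega
  have hκ' : (0 : ℝ) < κ := by exact_mod_cast hκ
  have hbd := fun m => @two_pow_mul_orderKSum_bounds k N κ hκ hk0 (by omega) m
  have hlk : (k : ℝ) * ((N : ℝ) / κ) ≤ 40 := by
    rw [← mul_div_assoc, div_le_iff₀ hκ']
    have : k * N ≤ 40 * κ := by nlinarith
    exact_mod_cast this
  have hB : ∀ n, fpVal k N κ n < 2 ^ 100 := by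
    intro n
    have h1 := (hbd 0 n).1
    have h2 := orderKSum_le_exp k (lam := (N : ℝ) / κ) (by positivity) n
    have h3 : Real.exp (k * ((N : ℝ) / κ)) ≤ Real.exp 1 ^ 40 := by
      rw [← Real.exp_nat_mul]
      exact Real.exp_le_exp.2 (by push_cast; linarith)
    have h4 : Real.exp 1 ^ 40 ≤ 2.7182818286 ^ 40 :=
      pow_le_pow_left₀ (Real.exp_pos 1).le Real.exp_one_lt_d9.le 40
    have h5 : (2 : ℝ) ^ 40 * 2.7182818286 ^ 40 < 2 ^ 100 := by norm_num
    have h6 : (fpVal k N κ n : ℝ) < 2 ^ 100 := by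
      refine lt_of_le_of_lt (h1.trans ?_) h5
      gcongr
      exact h2.trans (h3.trans h4)
    exact_mod_cast h6
  rw [modeCheck_eq] at hcheck
  have h0 : fpVal k N κ 0 = 2 ^ 40 := fpVal_zero k N κ
  obtain ⟨one, hone⟩ : ∃ one : ℕ, one = 2 ^ 40 := ⟨_, rfl⟩
  obtain ⟨B, hBdef⟩ : ∃ B : ℕ, B = 2 ^ 100 := ⟨_, rfl⟩
  have honeB : one < B := by
    rw [hone, hBdef]
    exact Nat.pow_lt_pow_right (by norm_num) (by norm_num)
  rw [← hone] at h0
  rw [← hBdef] at hB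
  rw [← hone, ← hBdef] at hcheck
  have hrun := runRec_eq hk0 hB (1 + m) 0 (modeTest B one)
  have e0 : fpPack k N κ B 0 % B ^ (k + 1) = one := by
    rw [fpPack, h0]
    exact Nat.mod_eq_of_lt (honeB.trans_le (Nat.le_self_pow (by omega) B))
  have e1 : fpSum₁ k N κ 0 = one := by
    obtain ⟨k, rfl⟩ := Nat.exists_eq_add_of_le' hk0
    unfold fpSum₁
    rw [Finset.sum_range_succ', fpPrev_zero, h0, Finset.sum_eq_zero, zero_add]
    intro j _
    rw [fpPrev_eq]; simp
  have e2 : fpSum₂ k N κ 0 = one := by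
    obtain ⟨k, rfl⟩ := Nat.exists_eq_add_of_le' hk0
    unfold fpSum₂
    rw [Finset.sum_range_succ', fpPrev_zero, h0, Finset.sum_eq_zero]
    · simp
    intro j _
    rw [fpPrev_eq]; simp
  rw [e0, e1, e2, zero_add, zero_add, hcheck, eq_comm, modeTest_iff] at hrun
  have hdig : ∀ j, j ≤ k → fpPack k N κ B (1 + m) % B ^ (k + 1) / B ^ j % B =
      fpPrev k N κ (1 + m) j := by
    intro j hj
    rw [show B ^ (k + 1) = B ^ j * (B * B ^ (k - j)) by
      rw [← pow_succ', ← pow_add]; congr 1; omega, Nat.mod_mul_right_div_self,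
      Nat.mod_mul_right_mod, fpPack_div k N κ hB]
  have d0 := hdig 0 (by omega)
  have d1 := hdig 1 (by omega)
  have d2 := hdig 2 hk
  rw [pow_zero, Nat.div_one, fpPrev_zero, add_comm] at d0
  rw [pow_one, add_comm, fpPrev_succ, fpPrev_zero] at d1
  rw [pow_two, add_comm, fpPrev_succ, fpPrev_eq, if_pos hm1] at d2
  rw [add_comm 1 m, d0, d1, d2] at hrun
  obtain ⟨c0, c1, c2⟩ := hrun
  have hN40 : m + 1 + 1 ≤ one := by
    have : 20 * (k + 1) ≤ 400 := by omega
    have : 2 ^ 40 = 1099511627776 := by norm_num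
    omega
  have honeR : (one : ℝ) = 2 ^ 40 := by rw [hone]; norm_num
  have c1' : (fpVal k N κ (m - 1) : ℝ) * one < fpVal k N κ m * (one - (m + 1 + 1 : ℕ)) := by
    rw [← Nat.cast_sub (by omega)]; exact_mod_cast (by simpa [add_comm, add_assoc] using c1)
  have c2' : (fpVal k N κ (m + 1) : ℝ) * one < fpVal k N κ m * (one - (m + 1 + 1 : ℕ)) := by
    rw [← Nat.cast_sub (by omega)]; exact_mod_cast (by simpa [add_comm, add_assoc] using c2)
  have hN40R : ((m + 1 + 1 : ℕ) : ℝ) ≤ one := by exact_mod_cast hN40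
  have hone0 : (0 : ℝ) < one := by rw [honeR]; positivity
  have u := fun i => (hbd (m + 1) i).1
  have l := fun i => (hbd (m + 1) i).2
  rw [← honeR] at u l
  have hp := fun i => orderKSum_pos (lam := (N : ℝ) / κ) hk0
    (div_pos (by exact_mod_cast (by omega : 0 < N)) hκ') i
  have hp1 : 1 ≤ orderKSum k ((N : ℝ) / κ) (m + 1) := by
    have h1 : (one : ℝ) ≤ fpVal k N κ (m + 1) := by exact_mod_cast c0
    exact le_of_mul_le_mul_left (by linarith [u (m + 1)]) hone0
  have key : ∀ i ≤ m + 1, (fpVal k N κ i : ℝ) * one < fpVal k N κ m * (one - (m + 1 + 1 : ℕ)) →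
      orderKSum k ((N : ℝ) / κ) i < orderKSum k ((N : ℝ) / κ) m := by
    intro i hi hlt
    have hiR : (i : ℝ) ≤ (m + 1 + 1 : ℕ) := by exact_mod_cast (by omega : i ≤ m + 1 + 1)
    have hiR' : 0 < (one : ℝ) - i := by
      have : (i : ℝ) < one := by exact_mod_cast (by omega : i < one)
      linarith
    have h1 := mul_le_mul_of_nonneg_right (l i hp1 hi) hone0.le
    have h2 := mul_le_mul_of_nonneg_right (u m) (sub_nonneg.2 hN40R)
    have h3 : ((one : ℝ) - i) * orderKSum k ((N : ℝ) / κ) i * one <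
        one * orderKSum k ((N : ℝ) / κ) m * (one - i) := by
      refine (h1.trans_lt hlt).trans_le (h2.trans ?_)
      exact mul_le_mul_of_nonneg_left (by linarith) (mul_pos hone0 (hp m)).le
    have h4 : (one : ℝ) * (one - i) * orderKSum k ((N : ℝ) / κ) i <
        one * (one - i) * orderKSum k ((N : ℝ) / κ) m := by linarith
    exact lt_of_mul_lt_mul_left h4 (mul_pos hone0 hiR').le
  exact ⟨key (m - 1) (by omega) c1', key (m + 1) le_rfl c2'⟩

theorem powSum_one (k : ℕ) : powSum k 1 = ((k * (k + 1) / 2 : ℕ) : ℝ) := by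
  have h : 2 * powSum k 1 = (k : ℝ) * (k + 1) := by
    induction k with
    | zero => simp [powSum]
    | succ k ih =>
      unfold powSum at ih ⊢
      rw [Finset.sum_range_succ, mul_add, ih]
      push_cast
      ring
  have h2 : 2 * (k * (k + 1) / 2) = k * (k + 1) :=
    Nat.two_mul_div_two_of_even (Nat.even_mul_succ_self k)
  have h3 : (2 : ℝ) * ((k * (k + 1) / 2 : ℕ) : ℝ) = (k : ℝ) * (k + 1) := by exact_mod_cast h2
  linarith

/-- At the mean `N ≥ k (k + 1)`, the mode lies strictly between `N - ⌊(3k+5)/8⌋ - 1` and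
`N - ⌊(3k+5)/8⌋ + 1`. -/
theorem orderKSum_lt_of_mean {k N : ℕ} (hk : 2 ≤ k) (hN : k * (k + 1) ≤ N) :
    orderKSum k ((N : ℝ) / (k * (k + 1) / 2 : ℕ)) (N - (3 * k + 5) / 8 - 1) <
      orderKSum k ((N : ℝ) / (k * (k + 1) / 2 : ℕ)) (N - (3 * k + 5) / 8) ∧
    orderKSum k ((N : ℝ) / (k * (k + 1) / 2 : ℕ)) (N - (3 * k + 5) / 8 + 1) <
      orderKSum k ((N : ℝ) / (k * (k + 1) / 2 : ℕ)) (N - (3 * k + 5) / 8) := by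
  obtain hN' | hN' := lt_or_ge N (20 * (k + 1))
  · exact orderKSum_lt_of_small hk hN hN'
  have hk2 : (2 : ℝ) ≤ k := by exact_mod_cast hk
  have hp := powSum_one k
  have h2 : (2 : ℝ) * ((k * (k + 1) / 2 : ℕ) : ℝ) = (k : ℝ) * (k + 1) := by
    exact_mod_cast Nat.two_mul_div_two_of_even (Nat.even_mul_succ_self k)
  set κ : ℝ := ((k * (k + 1) / 2 : ℕ) : ℝ)
  have hκ : 0 < κ := by nlinarith
  have hNr : (k : ℝ) * (k + 1) ≤ N := by exact_mod_cast hN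
  have hNr' : (20 : ℝ) * (k + 1) ≤ N := by exact_mod_cast hN'
  obtain ⟨lam, hlam⟩ : ∃ lam : ℝ, lam = N / κ := ⟨_, rfl⟩
  have hlκ : lam * κ = N := by rw [hlam]; field_simp
  rw [← hlam]
  have hl : 2 ≤ lam := by rw [hlam, le_div_iff₀ hκ]; linarith
  have hlk : 40 ≤ lam * k := by
    have : lam * k * (k + 1) = 2 * N := by linear_combination 2 * hlκ - lam * h2
    by_contra! h
    nlinarith
  obtain ⟨q, ρ, hq, hρ, hqρ⟩ : ∃ q ρ : ℕ, (3 * k + 5) / 8 = q ∧ ρ < 8 ∧ 3 * k + 5 = 8 * q + ρ :=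
    ⟨(3 * k + 5) / 8, (3 * k + 5) % 8, rfl, Nat.mod_lt _ (by norm_num), by omega⟩
  rw [hq]
  have hqr : 3 * (k : ℝ) + 5 = 8 * q + ρ := by exact_mod_cast hqρ
  have hρ7 : (ρ : ℝ) ≤ 7 := by exact_mod_cast (by omega : ρ ≤ 7)
  have hρ0 : (0 : ℝ) ≤ ρ := ρ.cast_nonneg
  have hq1 : (1 : ℝ) ≤ q := by exact_mod_cast (by omega : 1 ≤ q)
  have hqN : q + 1 ≤ N := by omega
  obtain ⟨K, hK⟩ : ∃ K : ℝ, K = k + 1 / 2 := ⟨_, rfl⟩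
  obtain ⟨x, hx⟩ : ∃ x : ℝ, x * K = 1 := ⟨K⁻¹, inv_mul_cancel₀ (by linarith)⟩
  have hx0 : 0 < x := pos_of_mul_pos_left (hx ▸ one_pos) (by linarith)
  have hx1 : x ≤ 2 / 5 := by nlinarith
  constructor
  · have h := mul_orderKSum_sub_neg (n := N - q - 1) (s := 1)
      (δ := (15 - 2 * ρ) / 16 + 3 * x / 32) hk hl hlk hK hx
      (by
        have : 3 * (1 - x ^ 2 / 4) / 8 + ((15 - 2 * ρ) / 16 + 3 * x / 32) * x =
          (q + 1 / 2) * x := by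
            linear_combination (-3 / 8) * hx + (x / 8) * hqr + (3 * x / 8) * hK
        rw [this]; positivity)
      (Or.inl ⟨rfl, by linarith, by linarith⟩)
      (by
        rw [hp, hlκ, Nat.sub_sub, Nat.cast_sub hqN]
        push_cast
        linarith)
    rw [show N - q - 1 + 1 = N - q by omega] at h
    linarith
  · have hδ : -(1 + 2 * (ρ : ℝ)) / 16 + 3 * x / 32 ≤ -1 / 19 := by
      rcases Nat.eq_zero_or_pos ρ with h0 | h0
      · have hk9 : (9 : ℝ) ≤ k := by exact_mod_cast (by omega : 9 ≤ k)
        have : x ≤ 1 / 9.5 := by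
          rw [le_div_iff₀ (by norm_num)]
          nlinarith
        rw [h0]; norm_num at this ⊢; linarith
      · have : (1 : ℝ) ≤ ρ := by exact_mod_cast h0
        linarith
    have h := mul_orderKSum_sub_neg (n := N - q) (s := -1)
      (δ := -(1 + 2 * ρ) / 16 + 3 * x / 32) hk hl hlk hK hx
      (by
        have : 3 * (1 - x ^ 2 / 4) / 8 + (-(1 + 2 * ρ) / 16 + 3 * x / 32) * x =
          (q - 1 / 2) * x := by
            linear_combination (-3 / 8) * hx + (x / 8) * hqr + (3 * x / 8) * hK
        rw [this]; exact mul_nonneg (by linarith) hx0.le)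
      (Or.inr ⟨rfl, by linarith, hδ⟩)
      (by
        rw [hp, hlκ, Nat.cast_sub (by omega)]
        linarith)
    linarith

/-- A double mode at `n - ⌊(3k+5)/8⌋` occurs for a mean in `(n, n + 1)`. -/
theorem exists_orderKSum_double_mode {k n : ℕ} (hk : 2 ≤ k) (hn : k * (k + 1) ≤ n) :
    ∃ lam : ℝ, 0 < lam ∧ (n : ℝ) < ((k * (k + 1) / 2 : ℕ) : ℝ) * lam ∧
      ((k * (k + 1) / 2 : ℕ) : ℝ) * lam < (n : ℝ) + 1 ∧
      orderKSum k lam (n - (3 * k + 5) / 8) = orderKSum k lam (n - (3 * k + 5) / 8 + 1) ∧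
      ∀ j, orderKSum k lam j ≤ orderKSum k lam (n - (3 * k + 5) / 8) := by
  have hk2 : (2 : ℝ) ≤ k := by exact_mod_cast hk
  have hlo := (orderKSum_lt_of_mean hk hn).2
  have hhi := (orderKSum_lt_of_mean hk (hn.trans n.le_succ)).1
  have hqn : (3 * k + 5) / 8 ≤ n := by
    have : (3 * k + 5) / 8 ≤ k * (k + 1) := by
      have : 2 * k ≤ k * k := Nat.mul_le_mul_right k hk
      rw [mul_add]
      omega
    omega
  rw [show n + 1 - (3 * k + 5) / 8 - 1 = n - (3 * k + 5) / 8 by omega,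
    show n + 1 - (3 * k + 5) / 8 = n - (3 * k + 5) / 8 + 1 by omega] at hhi
  have h2 : (2 : ℝ) * ((k * (k + 1) / 2 : ℕ) : ℝ) = (k : ℝ) * (k + 1) := by
    exact_mod_cast Nat.two_mul_div_two_of_even (Nat.even_mul_succ_self k)
  have hnr : (k : ℝ) * (k + 1) ≤ n := by exact_mod_cast hn
  push_cast only [Nat.cast_succ] at hhi
  set κ : ℝ := ((k * (k + 1) / 2 : ℕ) : ℝ)
  set m := n - (3 * k + 5) / 8
  have hκ : 0 < κ := by nlinarith
  have hle : (n : ℝ) / κ ≤ ((n : ℝ) + 1) / κ := by gcongr; linarith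
  obtain ⟨lam, ⟨hl1, hl2⟩, hroot⟩ := intermediate_value_Ioo' (a := (n : ℝ) / κ)
    (b := ((n : ℝ) + 1) / κ) hle
    (f := fun lam => orderKSum k lam m - orderKSum k lam (m + 1))
    ((continuous_orderKSum k m).sub (continuous_orderKSum k (m + 1))).continuousOn
    (show (0 : ℝ) ∈ Set.Ioo _ _ from ⟨sub_neg.2 hhi, sub_pos.2 hlo⟩)
  have heq := sub_eq_zero.1 hroot
  rw [div_lt_iff₀' hκ] at hl1
  rw [lt_div_iff₀' hκ] at hl2
  have hl : 2 ≤ lam := by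
    by_contra! h
    nlinarith
  exact ⟨lam, by linarith, hl1, hl2, heq, orderKSum_le_of_eq (by omega) hl heq⟩

/-- Conjecture: For k > 1 and an integer n ≥ 2κ, with
m = n − ⌊(3k+5)/8⌋, one has β_(k,n) − n ∈ (0,1): there exists λ > 0 with
n < κλ < n + 1 at which the distribution has a double mode at the consecutive integers
m and m + 1. In particular, for every k > 1 there is a denumerable infinity of values
of λ at which the Poisson distribution of order k has a double mode. -/
theorem poissonOrderK_beta_bounds (k n : ℕ) (hk : 1 < k)
    (hn : 2 * (k * (k + 1) / 2) ≤ n) :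
    (∃ lam : ℝ, 0 < lam ∧
      (n : ℝ) < ((k * (k + 1) / 2 : ℕ) : ℝ) * lam ∧
      ((k * (k + 1) / 2 : ℕ) : ℝ) * lam < (n : ℝ) + 1 ∧
      poissonOrderKPmf k lam (n - (3 * k + 5) / 8) =
        poissonOrderKPmf k lam (n - (3 * k + 5) / 8 + 1) ∧
      (∀ j : ℕ, poissonOrderKPmf k lam j ≤
        poissonOrderKPmf k lam (n - (3 * k + 5) / 8))) ∧
    {lam : ℝ | 0 < lam ∧ ∃ m : ℕ,
      (∀ j : ℕ, poissonOrderKPmf k lam j ≤ poissonOrderKPmf k lam m) ∧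
      poissonOrderKPmf k lam m = poissonOrderKPmf k lam (m + 1)}.Infinite := by
  have hk0 : Even (k * (k + 1)) := Nat.even_mul_succ_self k
  have hmode : ∀ N, k * (k + 1) ≤ N → ∃ lam : ℝ, 0 < lam ∧
      (N : ℝ) < ((k * (k + 1) / 2 : ℕ) : ℝ) * lam ∧
      ((k * (k + 1) / 2 : ℕ) : ℝ) * lam < (N : ℝ) + 1 ∧
      poissonOrderKPmf k lam (N - (3 * k + 5) / 8) =
        poissonOrderKPmf k lam (N - (3 * k + 5) / 8 + 1) ∧
      ∀ j : ℕ, poissonOrderKPmf k lam j ≤ poissonOrderKPmf k lam (N - (3 * k + 5) / 8) := by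
    intro N hN
    obtain ⟨lam, h0, h1, h2, h3, h4⟩ := exists_orderKSum_double_mode hk hN
    exact ⟨lam, h0, h1, h2, congrArg (Real.exp (-(k * lam)) * ·) h3,
      fun j => mul_le_mul_of_nonneg_left (h4 j) (Real.exp_pos _).le⟩
  rw [Nat.two_mul_div_two_of_even hk0] at hn
  refine ⟨hmode n hn, ?_⟩
  choose lam h0 h1 h2 h3 h4 using fun i : ℕ => hmode (n + i) (by omega)
  refine Set.infinite_of_injective_forall_mem (f := lam) (fun i j hij => ?_)
    fun i => ⟨h0 i, _, h4 i, h3 i⟩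
  have h5 := h1 i
  have h6 := h2 i
  rw [hij] at h5 h6
  have h7 : n + i < n + j + 1 := by exact_mod_cast h5.trans (h2 j)
  have h8 : n + j < n + i + 1 := by exact_mod_cast (h1 j).trans h6
  omega
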